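/- arXiv:1610.08444 — 7 statements merged into one kernel-verified Lean document; each statement's English description precedes it below -/
import Mathlib

section
/- Let k be a field of characteristic 0 and let f = (f₁,…,f_r) : k^m → k^r be a polynomial map such that df₁ ∧ … ∧ df_r is not identically zero (equivalently, the Jacobian matrix of f has rank r at some point). Then the set CV(f) of critical values of f is not Zariski dense in k^r; that is, there exists a nonzero polynomial g ∈ k[y₁,…,y_r] that vanishes at every critical value of f. -/
open MvPolynomial

/-- A matrix over a field with linearly independent rows has a nonvanishing maximal minor. -/
theorem Matrix.exists_submatrix_det_ne_zero_of_linearIndependent_row {K : Type*} [Field K]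
    {m r : ℕ} (M : Matrix (Fin r) (Fin m) K) (hM : LinearIndependent K M.row) :
    ∃ c : Fin r → Fin m, (M.submatrix id c).det ≠ 0 := by
  have hrank : Module.finrank K (Submodule.span K (Set.range M.col)) = r := by
    rw [← M.rank_eq_finrank_span_cols, hM.rank_matrix, Fintype.card_fin]
  obtain ⟨v, hv, -, hli⟩ :=
    Submodule.exists_fun_fin_finrank_span_eq K (Set.range M.col)
  generalize Module.finrank K (Submodule.span K (Set.range M.col)) = n at v hv hli hrank
  subst hrank
  choose c hc using hv
  refine ⟨c, ?_⟩
  have hcol : (M.submatrix id c).col = v := funext hc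
  have := Matrix.linearIndependent_cols_iff_isUnit.1 (hcol ▸ hli)
  exact ((Matrix.isUnit_iff_isUnit_det _).1 this).ne_zero

/-- In a finitely generated field extension of characteristic zero, the differentials of
algebraically independent elements are linearly independent. -/
theorem AlgebraicIndependent.linearIndependent_D {k K ι : Type*} [Field k] [CharZero k] [Field K]
    [Algebra k K] [Algebra.EssFiniteType k K] {v : ι → K} (hv : AlgebraicIndependent k v) :
    LinearIndependent K fun i => KaehlerDifferential.D k K (v i) := by
  let B := MvPolynomial ι k
  let F := FractionRing B
  let : Algebra B K := (aeval v).toRingHom.toAlgebra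
  have : IsScalarTower k B K := IsScalarTower.of_algebraMap_eq fun x =>
    ((aeval v).commutes x).symm
  have : FaithfulSMul B K := (faithfulSMul_iff_algebraMap_injective B K).2 hv
  let : Algebra F K := FractionRing.liftAlgebra B K
  have : IsScalarTower B F K := inferInstance
  have : IsScalarTower k F K := .of_algebraMap_eq fun x => by
    rw [IsScalarTower.algebraMap_apply k B K, IsScalarTower.algebraMap_apply B F K,
      ← IsScalarTower.algebraMap_apply k B F]
  have : CharZero F := charZero_of_injective_algebraMap (algebraMap k F).injective
  have : Algebra.EssFiniteType F K := .of_comp k F K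
  have : Algebra.FormallySmooth B F := .of_isLocalization (nonZeroDivisors B)
  have : Algebra.FormallySmooth B K := .comp B F K
  have hinj : Function.Injective (KaehlerDifferential.mapBaseChange k B K) := by
    rw [injective_iff_map_eq_zero]
    intro x hx
    obtain ⟨x, rfl⟩ := (Algebra.H1Cotangent.exact_δ_mapBaseChange k B K x).mp hx
    rw [Subsingleton.elim x 0, map_zero]
  have hb := ((KaehlerDifferential.mvPolynomialBasis k ι).baseChange K).linearIndependent.map'
    _ (LinearMap.ker_eq_bot.2 hinj)
  convert! hb using 1
  ext i
  have : algebraMap B K (X i) = v i := aeval_X v i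
  simp [KaehlerDifferential.mapBaseChange_tmul, B, ← this]

/-- If the images in a finitely generated field extension of characteristic zero of polynomials
`f i` under evaluation at `x` are algebraically independent, the Jacobian matrix of `f` at `x` has
linearly independent rows. -/
theorem MvPolynomial.linearIndependent_row_jacobian {k K ι σ : Type*} [Field k] [CharZero k]
    [Field K] [Algebra k K] [Algebra.EssFiniteType k K] [Fintype σ] (f : ι → MvPolynomial σ k)
    (x : σ → K) (h : AlgebraicIndependent k fun i => aeval x (f i)) :
    LinearIndependent K (Matrix.of fun i j => aeval x (pderiv j (f i))).row := by
  have hD (p : MvPolynomial σ k) : KaehlerDifferential.D k K (aeval x p) =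
      Fintype.linearCombination K (fun j => KaehlerDifferential.D k K (x j))
        (fun j => aeval x (pderiv j p)) := by
    rw [Fintype.linearCombination_apply]
    induction p using MvPolynomial.induction_on with
    | C a => simp
    | add p q hp hq => simp [hp, hq, add_smul, Finset.sum_add_distrib]
    | mul_X p i hp =>
      classical
      simp [hp, pderiv_X, Pi.single_apply, add_smul, mul_smul, Finset.sum_add_distrib,
        Finset.smul_sum, apply_ite, ite_smul]
  refine LinearIndependent.of_comp
    (Fintype.linearCombination K (fun j => KaehlerDifferential.D k K (x j))) ?_
  convert! h.linearIndependent_D using 1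
  ext i
  exact (hD (f i)).symm

/-- Let `k` be a field of characteristic 0 and
`f = (f₁,…,f_r) : k^m → k^r` a polynomial map whose Jacobian matrix has rank `r`
at some point (i.e. `df₁ ∧ … ∧ df_r` is not identically zero).  Then the set of
critical values of `f` is not Zariski dense in `k^r`: there is a nonzero
polynomial `g` vanishing at every critical value. -/
theorem stmt0 {k : Type*} [Field k] [CharZero k] {m r : ℕ}
    (f : Fin r → MvPolynomial (Fin m) k)
    (hrank : ∃ x : Fin m → k,
      (Matrix.of fun i j => eval x (pderiv j (f i)) : Matrix (Fin r) (Fin m) k).rank = r) :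
    ∃ g : MvPolynomial (Fin r) k, g ≠ 0 ∧
      ∀ x : Fin m → k,
        (Matrix.of fun i j => eval x (pderiv j (f i)) : Matrix (Fin r) (Fin m) k).rank < r →
        eval (fun i => eval x (f i)) g = 0 := by
  let C : Set (Fin m → k) := {x | (Matrix.of fun i j => eval x (pderiv j (f i)) :
    Matrix (Fin r) (Fin m) k).rank < r}
  let I : Ideal (MvPolynomial (Fin m) k) := ⨅ x ∈ C, RingHom.ker (eval x)
  have hI {p : MvPolynomial (Fin m) k} : p ∈ I ↔ ∀ x ∈ C, eval x p = 0 := by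
    simp [I, Submodule.mem_iInf, RingHom.mem_ker]
  by_contra! hg
  let S : Submonoid (MvPolynomial (Fin m) k) :=
    (nonZeroDivisors (MvPolynomial (Fin r) k)).map (aeval f)
  have hdisj : Disjoint (I : Set (MvPolynomial (Fin m) k)) S := by
    rw [Set.disjoint_left]
    rintro _ hp ⟨g, hg0, rfl⟩
    obtain ⟨x, hx, hne⟩ := hg g (nonZeroDivisors.ne_zero hg0)
    refine hne ?_
    have := hI.1 hp x hx
    simpa only [← coe_aeval_eq_eval, RingHom.coe_coe, comp_aeval_apply] using this
  obtain ⟨P, hP, hIP, hPS⟩ := Ideal.exists_le_prime_disjoint I S hdisj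
  let A := MvPolynomial (Fin m) k ⧸ P
  let K := FractionRing A
  have : Algebra.EssFiniteType k K := .comp k A K
  let φ : MvPolynomial (Fin m) k →ₐ[k] K :=
    (IsScalarTower.toAlgHom k A K).comp (Ideal.Quotient.mkₐ k P)
  have hφ (p : MvPolynomial (Fin m) k) : φ p = 0 ↔ p ∈ P := by
    rw [← Ideal.Quotient.eq_zero_iff_mem]
    exact map_eq_zero_iff _ (IsFractionRing.injective A K)
  have hφx (p) : aeval (fun j => φ (X j)) p = φ p := by
    rw [← comp_aeval_apply, aeval_X_left_apply]
  have hind : AlgebraicIndependent k fun i => aeval (fun j => φ (X j)) (f i) := by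
    rw [algebraicIndependent_iff]
    intro g hg0
    by_contra hne
    refine Set.disjoint_left.1 hPS ((hφ (aeval f g)).1 ?_)
      ⟨g, mem_nonZeroDivisors_of_ne_zero hne, rfl⟩
    simp_rw [← hg0, hφx, comp_aeval_apply]
  obtain ⟨c, hc⟩ := Matrix.exists_submatrix_det_ne_zero_of_linearIndependent_row _
    (linearIndependent_row_jacobian f _ hind)
  have hminor : (Matrix.of fun i j => pderiv (c j) (f i)).det ∈ I := by
    rw [hI]
    intro x hx
    rw [RingHom.map_det]
    by_contra hne
    have h1 := Matrix.rank_of_det_ne_zero hne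
    have h2 := Matrix.rank_submatrix_le
      (Matrix.of fun i j => eval x (pderiv j (f i)) : Matrix (Fin r) (Fin m) k) id c
    rw [Fintype.card_fin] at h1
    exact absurd hx (not_lt.2 (h1.symm.le.trans h2))
  refine hc ?_
  rw [← (hφ _).2 (hIP hminor), AlgHom.map_det]
  congr 1
  ext i j
  exact hφx _
end

section
/- Let k be a field of characteristic 0 and let f : k^m → k be a non-constant polynomial. Then the set CV(f) = {f(x) : x ∈ k^m, ∇f(x) = 0} of critical values of f is finite. -/
open MvPolynomial

/-- In characteristic zero, an element of an essentially finitely generated field extension whose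
differential vanishes is algebraic over the base field. -/
theorem isAlgebraic_of_kaehlerDifferential_D_eq_zero {k L : Type*} [Field k] [CharZero k] [Field L]
    [Algebra k L] [Algebra.EssFiniteType k L] {a : L} (ha : KaehlerDifferential.D k L a = 0) :
    IsAlgebraic k a := by
  by_contra htr
  let : Algebra (Polynomial k) L := (Polynomial.aeval a).toRingHom.toAlgebra
  have halg (p : Polynomial k) : algebraMap (Polynomial k) L p = Polynomial.aeval a p := rfl
  have : IsScalarTower k (Polynomial k) L :=
    .of_algebraMap_eq fun r ↦ by rw [halg, Polynomial.algebraMap_eq, Polynomial.aeval_C]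
  have : FaithfulSMul (Polynomial k) L := by
    rw [faithfulSMul_iff_algebraMap_injective]
    exact transcendental_iff_injective.mp htr
  let : Algebra (FractionRing (Polynomial k)) L := FractionRing.liftAlgebra (Polynomial k) L
  have : IsScalarTower k (FractionRing (Polynomial k)) L := .to₁₃₄ k (Polynomial k) _ L
  have : Algebra.EssFiniteType (FractionRing (Polynomial k)) L := .of_comp k _ L
  have : CharZero (FractionRing (Polynomial k)) := algebraRat.charZero _
  have : Algebra.FormallySmooth (Polynomial k) (FractionRing (Polynomial k)) :=
    .of_isLocalization (nonZeroDivisors _)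
  have : Algebra.FormallySmooth (Polynomial k) L := .comp _ (FractionRing (Polynomial k)) L
  have hzero : (1 : L) ⊗ₜ[Polynomial k] KaehlerDifferential.D k _ (Polynomial.X : Polynomial k)
      = 0 := by
    obtain ⟨z, hz⟩ := (Algebra.H1Cotangent.exact_δ_mapBaseChange k (Polynomial k) L
      (1 ⊗ₜ KaehlerDifferential.D k _ Polynomial.X)).mp (by simp [halg, ha])
    rw [← hz, Subsingleton.elim z 0, map_zero]
  have hone := congrArg ((TensorProduct.rid (Polynomial k) L) ∘
    (KaehlerDifferential.polynomialEquiv k).toLinearMap.lTensor L) hzero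
  simp at hone

/-- If all partial derivatives of `f` lie in a prime ideal `P`, then `f` is algebraic over the base
field modulo `P`. -/
theorem MvPolynomial.exists_aeval_mem_of_pderiv_mem {k σ : Type*} [Field k] [CharZero k] [Finite σ]
    (f : MvPolynomial σ k) (P : Ideal (MvPolynomial σ k)) [P.IsPrime]
    (h : ∀ i, pderiv i f ∈ P) : ∃ q : Polynomial k, q ≠ 0 ∧ Polynomial.aeval f q ∈ P := by
  let L := P.ResidueField
  have : Algebra.EssFiniteType k L := .comp k (MvPolynomial σ k) L
  have hker (p : MvPolynomial σ k) : algebraMap _ L p = 0 ↔ p ∈ P :=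
    Ideal.algebraMap_residueField_eq_zero
  have hD : KaehlerDifferential.D k L (algebraMap _ L f) = 0 := by
    have := Fintype.ofFinite σ
    rw [← KaehlerDifferential.map_D k k (MvPolynomial σ k) L f,
      ← (KaehlerDifferential.mvPolynomialBasis k σ).sum_repr (KaehlerDifferential.D _ _ f), map_sum]
    refine Finset.sum_eq_zero fun i _ ↦ ?_
    rw [KaehlerDifferential.mvPolynomialBasis_repr_apply, map_smul, ← algebraMap_smul L,
      (hker _).mpr (h i), zero_smul]
  obtain ⟨q, hq, hq0⟩ := isAlgebraic_of_kaehlerDifferential_D_eq_zero hD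
  refine ⟨q, hq, (hker _).mp ?_⟩
  rwa [← Polynomial.aeval_algebraMap_apply]

/-- Let `k` be a field of characteristic 0 and `f : k^m → k` a
non-constant polynomial.  Then the set of critical values
`CV(f) = {f(x) : ∇f(x) = 0}` is finite. -/
theorem stmt1 {k : Type*} [Field k] [CharZero k] {m : ℕ}
    (f : MvPolynomial (Fin m) k) (hf : f.totalDegree ≠ 0) :
    {y : k | ∃ x : Fin m → k, (∀ i, eval x (pderiv i f) = 0) ∧ eval x f = y}.Finite := by
  let J : Ideal (MvPolynomial (Fin m) k) := Ideal.span (Set.range fun i ↦ pderiv i f)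
  have hq (P : J.minimalPrimes) :
      ∃ q : Polynomial k, q ≠ 0 ∧ Polynomial.aeval f q ∈ (P : Ideal (MvPolynomial (Fin m) k)) := by
    have : (P : Ideal (MvPolynomial (Fin m) k)).IsPrime := P.2.1.1
    exact exists_aeval_mem_of_pderiv_mem f P fun i ↦
      P.2.1.2 (Ideal.subset_span (Set.mem_range_self i))
  choose q hq0 hqP using hq
  have : Finite J.minimalPrimes := (Ideal.finite_minimalPrimes_of_isNoetherianRing _ J).to_subtype
  refine (Set.finite_iUnion fun P ↦ (q P).rootSet_finite k).subset ?_
  rintro y ⟨x, hx, rfl⟩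
  have hJ : J ≤ RingHom.ker (eval x) := by
    rw [Ideal.span_le]
    rintro _ ⟨i, rfl⟩
    exact hx i
  have : (RingHom.ker (eval x)).IsPrime := RingHom.ker_isPrime _
  obtain ⟨P, hP, hPx⟩ := Ideal.exists_minimalPrimes_le hJ
  refine Set.mem_iUnion.mpr ⟨⟨P, hP⟩, (Polynomial.mem_rootSet).mpr ⟨hq0 _, ?_⟩⟩
  have hroot : aeval x (Polynomial.aeval f (q ⟨P, hP⟩)) = 0 := by
    simpa [coe_aeval_eq_eval] using hPx (hqP ⟨P, hP⟩)
  rwa [← Polynomial.aeval_algHom_apply, aeval_eq_eval] at hroot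
end

section
/- Let k be a non-archimedean local field of characteristic p > 0, let U ⊆ k^m be an open set, and let f : U → k^r be an analytic map (locally given by convergent power series in m variables). Let C ⊆ U be the set of points x at which the derivative Df(x) : k^m → k^r is not surjective. If p > m − r + 1, then f(C) has Haar measure zero in k^r. -/
open MeasureTheory
open Metric Filter Topology Module

section Linear

variable {k : Type*} [NontriviallyNormedField k] [CompleteSpace k]
  {E : Type*} [NormedAddCommGroup E] [NormedSpace k E] [FiniteDimensional k E]

theorem exists_continuousLinearEquiv_fst_eq {n : ℕ} (hE : finrank k E = n + 1)
    {l : E →L[k] k} (hl : l ≠ 0) :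
    ∃ L : E ≃L[k] k × (Fin n → k), ∀ x, (L x).1 = l x := by
  obtain ⟨v, hv⟩ : ∃ v, l v ≠ 0 := by
    by_contra! h
    exact hl (ContinuousLinearMap.ext h)
  have hr : Function.RightInverse ((ContinuousLinearMap.id k k).smulRight ((l v)⁻¹ • v)) l := by
    intro t
    simp [hv]
  let L := ContinuousLinearEquiv.equivOfRightInverse l _ hr
  have hd : finrank k l.ker = finrank k (Fin n → k) := by
    have := L.toLinearEquiv.finrank_eq
    rw [Module.finrank_prod] at this
    simp at this ⊢
    omega
  let e := ContinuousLinearEquiv.ofFinrankEq hd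
  exact ⟨L.trans ((ContinuousLinearEquiv.refl k k).prodCongr e), fun x => rfl⟩

theorem isOpen_setOf_continuousLinearMap_surjective {F : Type*} [NormedAddCommGroup F]
    [NormedSpace k F] [FiniteDimensional k F] :
    IsOpen {f : E →L[k] F | Function.Surjective f} := by
  convert isOpen_setOfPred_nat_le_rank (𝕜 := k) (E := E) (F := F) (finrank k F) using 1
  refine Set.ext fun f => ?_
  change Function.Surjective (f : E →ₗ[k] F) ↔
    (finrank k F : Cardinal) ≤ LinearMap.rank (f : E →ₗ[k] F)
  rw [← LinearMap.range_eq_top , LinearMap.rank, ← finrank_eq_rank, Nat.cast_le]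
  exact ⟨fun h => by rw [h, finrank_top], fun h =>
    Submodule.eq_top_of_finrank_eq (le_antisymm (Submodule.finrank_le _) h)⟩

theorem exists_analyticOnNhd_parametrization {n : ℕ} (hE : finrank k E = n + 1)
    {h : E → k} {x₀ : E} (hh : AnalyticAt k h x₀) (hd : fderiv k h x₀ ≠ 0)
    {U : Set E} (hU : U ∈ 𝓝 x₀) :
    ∃ (ψ : k × (Fin n → k) → E) (W : Set (k × (Fin n → k))), IsOpen W ∧ AnalyticOnNhd k ψ W ∧
      (∀ w ∈ W, ψ w ∈ U) ∧ (∀ w ∈ W, h (ψ w) = w.1) ∧ ψ '' W ∈ 𝓝 x₀ := by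
  have := FiniteDimensional.complete k E
  obtain ⟨L, hL⟩ := exists_continuousLinearEquiv_fst_eq hE hd
  let φ : E → k × (Fin n → k) := fun x => (h x, (L x).2)
  have hφ : AnalyticAt k φ x₀ :=
    hh.prod (((ContinuousLinearMap.snd k k (Fin n → k)).comp L.toContinuousLinearMap).analyticAt x₀)
  have hφ' : HasStrictFDerivAt φ (L : E →L[k] k × (Fin n → k)) x₀ := by
    have := hh.hasStrictFDerivAt.prodMk
      ((ContinuousLinearMap.snd k k (Fin n → k)).comp L.toContinuousLinearMap).hasStrictFDerivAt
    refine this.congr_fderiv ?_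
    ext x <;> simp [← hL]
  let Φ := hφ'.toOpenPartialHomeomorph φ
  have hx₀ : x₀ ∈ Φ.source := hφ'.mem_toOpenPartialHomeomorph_source
  have hΦ : ∀ x, Φ x = φ x := fun x => rfl
  have hs : AnalyticAt k Φ.symm (Φ x₀) :=
    Φ.analyticAt_symm' hx₀ hφ hφ'.hasFDerivAt.fderiv
  have hN : {w | w ∈ Φ.target ∧ AnalyticAt k Φ.symm w ∧ Φ.symm w ∈ U} ∈ 𝓝 (Φ x₀) := by
    refine inter_mem (Φ.open_target.mem_nhds (Φ.map_source hx₀))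
      (inter_mem ((isOpen_analyticAt k _).mem_nhds hs) ?_)
    exact (Φ.tendsto_symm hx₀) hU
  obtain ⟨W, hWN, hWo, hxW⟩ := _root_.mem_nhds_iff.1 hN
  refine ⟨Φ.symm, W, hWo, fun w hw => (hWN hw).2.1, fun w hw => (hWN hw).2.2, fun w hw => ?_, ?_⟩
  · have := congrArg Prod.fst (Φ.right_inv (hWN hw).1)
    exact this
  · filter_upwards [Φ.open_source.mem_nhds hx₀,
      (Φ.continuousAt hx₀).preimage_mem_nhds (hWo.mem_nhds hxW)] with x hx hxw
    exact ⟨Φ x, hxw, Φ.left_inv hx⟩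

end Linear

section Ultrametric

variable {k : Type*} [NontriviallyNormedField k]

theorem norm_sub_le_max_norm {V : Type*} [NormedAddCommGroup V] [IsUltrametricDist V] (x y : V) :
    ‖x - y‖ ≤ max ‖x‖ ‖y‖ := by
  simpa [dist_eq_norm] using dist_triangle_max x 0 y

/-- A finite set of representatives of the unit ball modulo the ball of radius `ϖ`. -/
structure IsUnitBallNet {V : Type*} [NormedAddCommGroup V] (ϖ : ℝ) (T : Finset V) : Prop where
  norm_le : ∀ c ∈ T, ‖c‖ ≤ 1
  exists_near : ∀ x, ‖x‖ ≤ 1 → ∃ c ∈ T, ‖x - c‖ ≤ ϖ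
  eq_of_near : ∀ c ∈ T, ∀ d ∈ T, ‖c - d‖ ≤ ϖ → c = d

theorem exists_isUnitBallNet [IsUltrametricDist k] [ProperSpace k] {ϖ : ℝ} (h0 : 0 < ϖ) (h1 : ϖ < 1) :
    ∃ S : Finset k, IsUnitBallNet ϖ S ∧ 2 ≤ S.card := by
  classical
  let s : Setoid k :=
    { r := fun x y => ‖x - y‖ ≤ ϖ
      iseqv := ⟨fun x => by simpa using h0.le, fun h => by rwa [norm_sub_rev], fun {x y z} h h' => by
        have := IsUltrametricDist.norm_add_le_max (x - y) (y - z)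
        rw [sub_add_sub_cancel] at this
        exact this.trans (max_le h h')⟩ }
  let g : k → k := fun x => (Quotient.mk s x).out
  have hg : ∀ x, ‖x - g x‖ ≤ ϖ := fun x => s.symm (Quotient.mk_out (s := s) x)
  have hgg : ∀ x y, ‖x - y‖ ≤ ϖ → g x = g y := fun x y h =>
    congrArg Quotient.out (Quotient.sound (s := s) h)
  have hfin : (g '' closedBall 0 1).Finite := by
    obtain ⟨t, -, htf, ht⟩ := (isCompact_closedBall (0 : k) 1).finite_cover_balls h0
    refine (htf.image g).subset ?_
    rintro _ ⟨x, hx, rfl⟩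
    obtain ⟨y, hy, hxy⟩ := Set.mem_iUnion₂.1 (ht hx)
    exact ⟨y, hy, (hgg x y (by simpa [dist_eq_norm] using (mem_ball.1 hxy).le)).symm⟩
  have hmem : ∀ x : k, ‖x‖ ≤ 1 → g x ∈ hfin.toFinset := fun x hx => by
    simp only [Set.Finite.mem_toFinset]
    exact ⟨x, by simpa using hx, rfl⟩
  refine ⟨hfin.toFinset, ⟨?_, fun x hx => ⟨g x, hmem x hx, hg x⟩, ?_⟩, ?_⟩
  · intro c hc
    obtain ⟨x, hx, rfl⟩ := hfin.mem_toFinset.1 hc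
    have := norm_sub_le_max_norm x (x - g x)
    rw [sub_sub_cancel] at this
    exact this.trans (max_le (by simpa using hx) ((hg x).trans h1.le))
  · intro c hc d hd hcd
    obtain ⟨x, -, rfl⟩ := hfin.mem_toFinset.1 hc
    obtain ⟨y, -, rfl⟩ := hfin.mem_toFinset.1 hd
    exact hgg x y (s.trans (hg x) (s.trans hcd (s.symm (hg y))))
  · refine Finset.one_lt_card.2 ⟨g 1, hmem 1 (by simp), g 0, hmem 0 (by simp), fun h => ?_⟩
    have : ‖(1 : k) - 0‖ ≤ ϖ := s.trans (h ▸ hg 1) (s.symm (hg 0))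
    simp at this
    linarith

theorem IsUnitBallNet.pi {ϖ : ℝ} (h0 : 0 < ϖ) {S : Finset k} (hS : IsUnitBallNet ϖ S) (d : ℕ) :
    IsUnitBallNet ϖ (Fintype.piFinset fun _ : Fin d => S) where
  norm_le c hc := (pi_norm_le_iff_of_nonneg zero_le_one).2 fun i =>
    hS.norm_le _ (Fintype.mem_piFinset.1 hc i)
  exists_near x hx := by
    choose c hc hxc using fun i => hS.exists_near (x i) ((norm_le_pi_norm x i).trans hx)
    exact ⟨c, Fintype.mem_piFinset.2 hc, (pi_norm_le_iff_of_nonneg h0.le).2 hxc⟩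
  eq_of_near c hc d hd hcd := by
    ext i
    exact hS.eq_of_near _ (Fintype.mem_piFinset.1 hc i) _ (Fintype.mem_piFinset.1 hd i)
      ((norm_le_pi_norm (c - d) i).trans hcd)

variable {V : Type*} [NormedAddCommGroup V] [NormedSpace k V]
  {π : k} {T : Finset V}

theorem IsUnitBallNet.closedBall_subset (hπ : 0 < ‖π‖) (hT : IsUnitBallNet ‖π‖ T) (x : V) (n : ℕ) :
    closedBall x (‖π‖ ^ n) ⊆ ⋃ c ∈ T, closedBall (x + π ^ n • c) (‖π‖ ^ (n + 1)) := by
  intro y hy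
  have hπ' : π ^ n ≠ 0 := pow_ne_zero _ (norm_pos_iff.1 hπ)
  rw [mem_closedBall, dist_eq_norm] at hy
  obtain ⟨c, hc, hyc⟩ := hT.exists_near ((π ^ n)⁻¹ • (y - x)) (by
    rw [norm_smul, norm_inv, norm_pow]
    exact inv_mul_le_one_of_le₀ hy (by positivity))
  refine Set.mem_iUnion₂.2 ⟨c, hc, ?_⟩
  rw [mem_closedBall, dist_eq_norm]
  have : y - (x + π ^ n • c) = π ^ n • ((π ^ n)⁻¹ • (y - x) - c) := by
    rw [smul_sub, smul_inv_smul₀ hπ']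
    abel
  rw [this, norm_smul, norm_pow, pow_succ]
  gcongr

theorem IsUnitBallNet.exists_cover (hπ : 0 < ‖π‖) (hT : IsUnitBallNet ‖π‖ T) (x : V) (n : ℕ) :
    ∃ t : Finset V, t.card ≤ T.card ^ n ∧ closedBall x 1 ⊆ ⋃ c ∈ t, closedBall c (‖π‖ ^ n) := by
  classical
  induction n with
  | zero => exact ⟨{x}, by simp⟩
  | succ n ih =>
    obtain ⟨t, ht, hc⟩ := ih
    refine ⟨(t ×ˢ T).image fun y => y.1 + π ^ n • y.2, ?_, ?_⟩
    · refine Finset.card_image_le.trans ?_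
      rw [Finset.card_product, pow_succ]
      gcongr
    · intro y hy
      obtain ⟨a, ha, hya⟩ := Set.mem_iUnion₂.1 (hc hy)
      obtain ⟨b, hb, hyb⟩ := Set.mem_iUnion₂.1 (hT.closedBall_subset hπ a n hya)
      exact Set.mem_iUnion₂.2 ⟨_, Finset.mem_image.2 ⟨(a, b), by simp [ha, hb], rfl⟩, hyb⟩

variable [IsUltrametricDist V] [MeasurableSpace V] [BorelSpace V]
  (μ : Measure V) [μ.IsAddHaarMeasure]

theorem IsUnitBallNet.card_mul_measure_le (hπ : 0 < ‖π‖) (h1 : ‖π‖ < 1) (hT : IsUnitBallNet ‖π‖ T)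
    (n : ℕ) :
    T.card * μ (closedBall 0 (‖π‖ ^ (n + 1))) ≤ μ (closedBall 0 (‖π‖ ^ n)) := by
  have key : ∑ c ∈ T, μ (closedBall (π ^ n • c) (‖π‖ ^ (n + 1))) ≤ μ (closedBall 0 (‖π‖ ^ n)) := by
    rw [← measure_biUnion_finset _ fun c _ => measurableSet_closedBall]
    · refine measure_mono (Set.iUnion₂_subset fun c hc y hy => ?_)
      rw [mem_closedBall, dist_eq_norm] at hy ⊢
      have := IsUltrametricDist.norm_add_le_max (y - π ^ n • c) (π ^ n • c)
      rw [sub_add_cancel] at this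
      rw [sub_zero]
      refine this.trans (max_le (hy.trans (pow_le_pow_of_le_one hπ.le h1.le n.le_succ)) ?_)
      rw [norm_smul, norm_pow]
      exact mul_le_of_le_one_right (by positivity) (hT.norm_le c hc)
    · intro c hc d hd hcd
      refine Set.disjoint_left.2 fun y hyc hyd => hcd (hT.eq_of_near c hc d hd ?_)
      rw [mem_closedBall, dist_eq_norm] at hyc hyd
      have := norm_sub_le_max_norm (y - π ^ n • d) (y - π ^ n • c)
      rw [sub_sub_sub_cancel_left, ← smul_sub, norm_smul, norm_pow] at this
      have := this.trans (max_le hyd hyc)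
      rw [pow_succ] at this
      exact le_of_mul_le_mul_left this (by positivity)
  simpa [Measure.addHaar_closedBall_center] using key

theorem IsUnitBallNet.card_pow_mul_measure_le (hπ : 0 < ‖π‖) (h1 : ‖π‖ < 1)
    (hT : IsUnitBallNet ‖π‖ T) (n : ℕ) :
    (T.card : ENNReal) ^ n * μ (closedBall 0 (‖π‖ ^ n)) ≤ μ (closedBall 0 1) := by
  induction n with
  | zero => simp
  | succ n ih =>
    rw [pow_succ, mul_assoc]
    exact (mul_le_mul_right (hT.card_mul_measure_le μ hπ h1 n) _).trans ih

end Ultrametric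

section Flat

variable {k : Type*} [NontriviallyNormedField k] [IsUltrametricDist k] [ProperSpace k]

theorem measure_image_inter_closedBall_null {m r s : ℕ} (hms : m < s * r)
    {f : (Fin m → k) → (Fin r → k)} {A : Set (Fin m → k)} {π : k} (hπ : 0 < ‖π‖) (h1 : ‖π‖ < 1)
    {N : ℕ} (hA : ∀ x ∈ A, ∀ y, ‖y - x‖ ≤ ‖π‖ ^ N → ‖π‖ ^ N * ‖f y - f x‖ ≤ ‖y - x‖ ^ s)
    [MeasurableSpace (Fin r → k)] [BorelSpace (Fin r → k)]
    (μ : Measure (Fin r → k)) [μ.IsAddHaarMeasure] (x₀ : Fin m → k) :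
    μ (f '' (A ∩ closedBall x₀ 1)) = 0 := by
  obtain ⟨S, hS, hcard⟩ := exists_isUnitBallNet (k := k) hπ h1
  set Q := S.card
  set X := μ (f '' (A ∩ closedBall x₀ 1))
  have hs : 0 < s := Nat.pos_of_ne_zero (by rintro rfl; simp at hms)
  have hQ : (1 : ENNReal) ≤ Q := by exact_mod_cast (by omega : 1 ≤ Q)
  have bound (n : ℕ) (hn : N ≤ n) :
      (Q : ENNReal) ^ n * X ≤ Q ^ (r * N) * μ (closedBall 0 1) := by
    obtain ⟨j, hj⟩ : ∃ j, s * n = j + N :=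
      ⟨s * n - N, (Nat.sub_add_cancel (by nlinarith)).symm⟩
    obtain ⟨t, ht, hcov⟩ := (hS.pi hπ m).exists_cover hπ x₀ n
    have hball (c : Fin m → k) :
        μ (f '' (A ∩ closedBall c (‖π‖ ^ n))) ≤ μ (closedBall 0 (‖π‖ ^ j)) := by
      rcases (A ∩ closedBall c (‖π‖ ^ n)).eq_empty_or_nonempty with he | ⟨x, hxA, hxc⟩
      · simp [he]
      · rw [← Measure.addHaar_closedBall_center μ (f x)]
        refine measure_mono ?_
        rintro _ ⟨y, ⟨-, hyc⟩, rfl⟩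
        have hyx : ‖y - x‖ ≤ ‖π‖ ^ n := by
          rw [← dist_eq_norm]
          exact (dist_triangle_max y c x).trans (max_le hyc (by rwa [dist_comm]))
        have h2 := hA x hxA y (hyx.trans (pow_le_pow_of_le_one hπ.le h1.le hn))
        have h3 : ‖y - x‖ ^ s ≤ (‖π‖ ^ n) ^ s := by gcongr
        rw [← pow_mul, mul_comm n, hj, add_comm, pow_add] at h3
        rw [mem_closedBall, dist_eq_norm]
        exact le_of_mul_le_mul_left (h2.trans h3) (by positivity)
    have hX : X ≤ Q ^ (m * n) * μ (closedBall 0 (‖π‖ ^ j)) := by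
      calc X ≤ μ (⋃ c ∈ t, f '' (A ∩ closedBall c (‖π‖ ^ n))) := by
            refine measure_mono ?_
            rintro _ ⟨y, ⟨hyA, hy⟩, rfl⟩
            obtain ⟨c, hc, hyc⟩ := Set.mem_iUnion₂.1 (hcov hy)
            exact Set.mem_iUnion₂.2 ⟨c, hc, y, ⟨hyA, hyc⟩, rfl⟩
        _ ≤ ∑ c ∈ t, μ (f '' (A ∩ closedBall c (‖π‖ ^ n))) := measure_biUnion_finset_le _ _
        _ ≤ ∑ c ∈ t, μ (closedBall 0 (‖π‖ ^ j)) := Finset.sum_le_sum fun c _ => hball c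
        _ = t.card * μ (closedBall 0 (‖π‖ ^ j)) := by simp
        _ ≤ _ := by
            gcongr
            rw [Fintype.card_piFinset_const, ← pow_mul] at ht
            exact_mod_cast ht
    have hB := (hS.pi hπ r).card_pow_mul_measure_le μ hπ h1 j
    rw [Fintype.card_piFinset_const, Nat.cast_pow, ← pow_mul] at hB
    have hexp : m * n + n ≤ r * N + r * j := by
      have : (m + 1) * n ≤ s * r * n := Nat.mul_le_mul_right _ hms
      have h4 : r * N + r * j = s * r * n := by rw [← mul_add, add_comm, ← hj]; ring
      rw [h4]
      linarith
    have h0 : (Q : ENNReal) ^ (m * n) ≠ 0 := pow_ne_zero _ (zero_lt_one.trans_le hQ).ne'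
    have ht : (Q : ENNReal) ^ (m * n) ≠ ⊤ := by finiteness
    refine (ENNReal.mul_le_mul_iff_right h0 ht).1 ?_
    calc (Q : ENNReal) ^ (m * n) * (Q ^ n * X) = Q ^ (m * n + n) * X := by ring
      _ ≤ Q ^ (r * N + r * j) * (Q ^ (m * n) * μ (closedBall 0 (‖π‖ ^ j))) := by gcongr
      _ = Q ^ (m * n) * Q ^ (r * N) * (Q ^ (r * j) * μ (closedBall 0 (‖π‖ ^ j))) := by ring
      _ ≤ Q ^ (m * n) * Q ^ (r * N) * μ (closedBall 0 1) := by gcongr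
      _ = _ := by ring
  by_contra hne
  have hfin : (Q : ENNReal) ^ (r * N) * μ (closedBall 0 1) ≠ ⊤ :=
    ENNReal.mul_ne_top (by finiteness) (isCompact_closedBall _ _).measure_ne_top
  obtain ⟨n, hn⟩ := ENNReal.exists_nat_mul_gt hne hfin
  refine (hn.trans_le ?_).not_ge (bound (max n N) (le_max_right _ _))
  gcongr
  exact_mod_cast (le_max_left n N).trans (Nat.lt_pow_self (by omega : 1 < Q)).le

theorem measure_image_null_of_isBigO_pi {m r s : ℕ} (hms : m < s * r)
    {f : (Fin m → k) → (Fin r → k)} {A : Set (Fin m → k)}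
    (hA : ∀ x ∈ A, (fun y => f y - f x) =O[𝓝 x] fun y => ‖y - x‖ ^ s)
    [MeasurableSpace (Fin r → k)] [BorelSpace (Fin r → k)]
    (μ : Measure (Fin r → k)) [μ.IsAddHaarMeasure] :
    μ (f '' A) = 0 := by
  obtain ⟨π, hπ, h1⟩ := NormedField.exists_norm_lt_one k
  let B : ℕ → Set (Fin m → k) := fun N =>
    {x | ∀ y, ‖y - x‖ ≤ ‖π‖ ^ N → ‖π‖ ^ N * ‖f y - f x‖ ≤ ‖y - x‖ ^ s}
  have hB (N : ℕ) : OuterMeasure.comap f μ.toOuterMeasure (B N) = 0 := by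
    refine measure_null_of_locally_null _ fun x _ => ⟨B N ∩ closedBall x 1,
      inter_mem_nhdsWithin _ (closedBall_mem_nhds x one_pos), ?_⟩
    exact measure_image_inter_closedBall_null hms hπ h1 (fun x hx => hx) μ x
  have hsub : A ⊆ ⋃ N, B N := by
    intro x hx
    obtain ⟨C, hC⟩ := (hA x hx).bound
    obtain ⟨ε, hε, hCε⟩ := Metric.eventually_nhds_iff.1 hC
    have hlim := tendsto_pow_atTop_nhds_zero_of_lt_one hπ.le h1
    have hlim' : Tendsto (fun n : ℕ => ‖π‖ ^ n * C) atTop (𝓝 0) := by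
      simpa using hlim.mul_const C
    obtain ⟨N, hN, hN'⟩ := ((hlim.eventually_lt_const hε).and
      (hlim'.eventually_lt_const one_pos)).exists
    refine Set.mem_iUnion.2 ⟨N, fun y hy => ?_⟩
    have := hCε (y := y) (by rw [dist_eq_norm]; linarith)
    rw [Real.norm_of_nonneg (by positivity)] at this
    calc ‖π‖ ^ N * ‖f y - f x‖ ≤ ‖π‖ ^ N * (C * ‖y - x‖ ^ s) := by gcongr
      _ = (‖π‖ ^ N * C) * ‖y - x‖ ^ s := by ring
      _ ≤ 1 * ‖y - x‖ ^ s := by gcongr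
      _ = _ := one_mul _
  exact measure_mono_null (μ := OuterMeasure.comap f μ.toOuterMeasure) hsub (measure_iUnion_null hB)

end Flat

section Sard

variable (k : Type*) [NontriviallyNormedField k]

/-- Analytic maps from open subsets of `k ^ n` to `k ^ r` have a null set of critical values. -/
def NullCriticalValues (n r : ℕ) : Prop :=
  ∀ (U : Set (Fin n → k)) (f : (Fin n → k) → (Fin r → k)), IsOpen U → AnalyticOnNhd k f U →
    ∀ [MeasurableSpace (Fin r → k)] [BorelSpace (Fin r → k)]
      (μ : Measure (Fin r → k)) [μ.IsAddHaarMeasure],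
      μ (f '' {x ∈ U | ¬ Function.Surjective (fderiv k f x)}) = 0

variable {k} [ProperSpace k] {n r : ℕ}

theorem NullCriticalValues.measure_image_zero_locus_null (H : NullCriticalValues k n r)
    (hr : r ≠ 0) {U : Set (Fin (n + 1) → k)} (hU : IsOpen U)
    {f : (Fin (n + 1) → k) → (Fin r → k)} (hf : AnalyticOnNhd k f U) {h : (Fin (n + 1) → k) → k}
    {x₀ : Fin (n + 1) → k} (hx₀ : x₀ ∈ U) (hh : AnalyticAt k h x₀) (hd : fderiv k h x₀ ≠ 0)
    [MeasurableSpace (Fin r → k)] [BorelSpace (Fin r → k)]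
    (μ : Measure (Fin r → k)) [μ.IsAddHaarMeasure] :
    ∃ V ∈ 𝓝 x₀, μ (f '' (V ∩ {x | h x = 0 ∧ fderiv k f x = 0})) = 0 := by
  obtain ⟨ψ, W, hWo, hψ, hψU, hhψ, hV⟩ :=
    exists_analyticOnNhd_parametrization (finrank_fin_fun k) hh hd (hU.mem_nhds hx₀)
  refine ⟨ψ '' W, hV, ?_⟩
  let i : (Fin n → k) →L[k] k × (Fin n → k) := ContinuousLinearMap.inr k k (Fin n → k)
  have hψi (z) (hz : i z ∈ W) : AnalyticAt k (ψ ∘ i) z := (hψ _ hz).comp (i.analyticAt z)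
  refine measure_mono_null ?_ (H (i ⁻¹' W) (f ∘ (ψ ∘ i)) (hWo.preimage i.continuous)
    (fun z hz => AnalyticAt.comp (f := ψ ∘ i) (hf _ (hψU _ hz)) (hψi z hz)) μ)
  rintro _ ⟨_, ⟨⟨w, hw, rfl⟩, h0, hfd⟩, rfl⟩
  have hw0 : i w.2 = w := Prod.ext (h0.symm.trans (hhψ w hw)) rfl
  have hw' : i w.2 ∈ W := hw0.symm ▸ hw
  refine ⟨w.2, ⟨hw', ?_⟩, by simp [hw0]⟩
  have : fderiv k (f ∘ (ψ ∘ i)) w.2 = 0 := by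
    rw [fderiv_comp (f := ψ ∘ i) _ (hf _ (hψU _ hw')).differentiableAt (hψi _ hw').differentiableAt]
    simp [hw0, hfd]
  rw [this]
  intro hs
  obtain ⟨z, hz⟩ := hs 1
  have := congrFun hz ⟨0, Nat.pos_of_ne_zero hr⟩
  simp at this

theorem isCompact_inter_setOf_not_surjective_fderiv {m : ℕ} {U K : Set (Fin m → k)}
    {f : (Fin m → k) → (Fin r → k)} (hf : AnalyticOnNhd k f U) (hK : IsCompact K) (hKU : K ⊆ U) :
    IsCompact (K ∩ {x ∈ U | ¬ Function.Surjective (fderiv k f x)}) := by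
  have hc : IsClosed (K ∩ fderiv k f ⁻¹' {g | Function.Surjective g}ᶜ) :=
    ContinuousOn.preimage_isClosed_of_isClosed (hf.fderiv.continuousOn.mono hKU) hK.isClosed
      isOpen_setOf_continuousLinearMap_surjective.isClosed_compl
  convert hK.of_isClosed_subset hc Set.inter_subset_left using 1
  ext x
  exact ⟨fun hx => ⟨hx.1, hx.2.2⟩, fun hx => ⟨hx.1, hKU hx.1, hx.2⟩⟩

theorem NullCriticalValues.measure_image_near_null (H : NullCriticalValues k n r)
    {U : Set (Fin (n + 1) → k)} (hU : IsOpen U)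
    {f : (Fin (n + 1) → k) → (Fin (r + 1) → k)} (hf : AnalyticOnNhd k f U)
    {x₀ : Fin (n + 1) → k} (hx₀ : x₀ ∈ U) (hd : fderiv k f x₀ ≠ 0)
    [MeasurableSpace (Fin (r + 1) → k)] [BorelSpace (Fin (r + 1) → k)]
    (μ : Measure (Fin (r + 1) → k)) [μ.IsAddHaarMeasure] :
    ∃ V ∈ 𝓝 x₀, μ (f '' (V ∩ {x ∈ U | ¬ Function.Surjective (fderiv k f x)})) = 0 := by
  obtain ⟨v, hv⟩ : ∃ v, fderiv k f x₀ v ≠ 0 := by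
    by_contra! h
    exact hd (ContinuousLinearMap.ext h)
  obtain ⟨j, hj⟩ := Function.ne_iff.1 hv
  let l : (Fin (r + 1) → k) →L[k] k := ContinuousLinearMap.proj j
  have hl : l ≠ 0 := fun h => hj (DFunLike.congr_fun h (fderiv k f x₀ v))
  obtain ⟨e, he⟩ := exists_continuousLinearEquiv_fst_eq (finrank_fin_fun k) hl
  have hfx (x) (hx : x ∈ U) : HasFDerivAt f (fderiv k f x) x :=
    (hf x hx).differentiableAt.hasFDerivAt
  have hlf (x) (hx : x ∈ U) : HasFDerivAt (l ∘ f) (l.comp (fderiv k f x)) x :=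
    l.hasFDerivAt.comp x (hfx x hx)
  have hd' : fderiv k (l ∘ f) x₀ ≠ 0 := by
    rw [(hlf x₀ hx₀).fderiv]
    exact fun h => hj (DFunLike.congr_fun h v)
  obtain ⟨ψ, W, hWo, hψ, hψU, hhψ, hV⟩ := exists_analyticOnNhd_parametrization (finrank_fin_fun k)
    ((l.analyticAt _).comp (hf x₀ hx₀)) hd' (hU.mem_nhds hx₀)
  obtain ⟨K, hK, hKV, hKc⟩ := local_compact_nhds (inter_mem hV (hU.mem_nhds hx₀))
  refine ⟨K, hK, ?_⟩
  set M := f '' (K ∩ {x ∈ U | ¬ Function.Surjective (fderiv k f x)})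
  have hM : IsCompact M :=
    (isCompact_inter_setOf_not_surjective_fderiv hf hKc (hKV.trans Set.inter_subset_right)
      ).image_of_continuousOn (hf.continuousOn.mono fun x hx => hx.2.1)
  borelize k
  borelize (Fin r → k)
  have : BorelSpace (k × (Fin r → k)) := inferInstance
  have : (μ.map e).IsAddHaarMeasure := e.isAddHaarMeasure_map μ
  have hac : μ.map e ≪ (Measure.addHaar : Measure k).prod (Measure.addHaar : Measure (Fin r → k)) :=
    Measure.absolutelyContinuous_isAddHaarMeasure _ _
  have hme : MeasurableEmbedding e := e.toHomeomorph.measurableEmbedding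
  suffices h : (Measure.addHaar : Measure k).prod (Measure.addHaar : Measure (Fin r → k))
      (e '' M) = 0 by
    have := hac h
    rwa [hme.map_apply, e.injective.preimage_image] at this
  refine Measure.measure_prod_null_of_ae_null (hM.image e.continuous).measurableSet
    (Eventually.of_forall fun t => ?_)
  let i : (Fin n → k) → k × (Fin n → k) := fun z => (t, z)
  have hi (z) : AnalyticAt k i z := analyticAt_const.prod analyticAt_id
  have hψi (z) (hz : i z ∈ W) : AnalyticAt k (ψ ∘ i) z := (hψ _ hz).comp (hi z)
  let P : (Fin (r + 1) → k) →L[k] (Fin r → k) :=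
    (ContinuousLinearMap.snd k k (Fin r → k)).comp e.toContinuousLinearMap
  refine measure_mono_null ?_ (H (i ⁻¹' W) (P ∘ (f ∘ (ψ ∘ i)))
    (hWo.preimage (by fun_prop)) (fun z hz => (P.analyticAt _).comp
      (AnalyticAt.comp (f := ψ ∘ i) (hf _ (hψU _ hz)) (hψi z hz))) Measure.addHaar)
  rintro y ⟨_, ⟨x, ⟨hxK, hxU, hxs⟩, rfl⟩, hxy⟩
  obtain ⟨w, hw, rfl⟩ := (hKV hxK).1
  have hwt : w.1 = t := by
    rw [← hhψ w hw]
    exact (he _).symm.trans (congrArg Prod.fst hxy)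
  have hiw : i w.2 = w := Prod.ext hwt.symm rfl
  have hw' : i w.2 ∈ W := hiw.symm ▸ hw
  refine ⟨w.2, ⟨hw', fun hs => hxs ?_⟩, ?_⟩
  · set D := fderiv k f (ψ w)
    set G := fderiv k (ψ ∘ i) w.2
    have hfψ : HasFDerivAt (f ∘ (ψ ∘ i)) (D.comp G) w.2 := by
      refine HasFDerivAt.comp _ ?_ (hψi _ hw').differentiableAt.hasFDerivAt
      simpa [hiw] using hfx _ hxU
    rw [(P.hasFDerivAt.comp _ hfψ).fderiv] at hs
    have hlG (z) : l (D (G z)) = 0 := by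
      have h1 : HasFDerivAt (l ∘ (f ∘ (ψ ∘ i))) (l.comp (D.comp G)) w.2 :=
        l.hasFDerivAt.comp _ hfψ
      have h2 : HasFDerivAt (l ∘ (f ∘ (ψ ∘ i))) (0 : (Fin n → k) →L[k] k) w.2 := by
        refine (hasFDerivAt_const t w.2).congr_of_eventuallyEq ?_
        filter_upwards [(hWo.preimage (by fun_prop : Continuous i)).mem_nhds hw'] with z hz
        exact hhψ _ hz
      exact DFunLike.congr_fun (h1.unique h2) z
    obtain ⟨u, hu⟩ : ∃ u, l (D u) ≠ 0 := by
      by_contra! hD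
      have h1 : HasFDerivAt ((l ∘ f) ∘ ψ) ((l.comp D).comp (fderiv k ψ w)) w :=
        (hlf _ hxU).comp w (hψ w hw).differentiableAt.hasFDerivAt
      have h2 : HasFDerivAt ((l ∘ f) ∘ ψ) (ContinuousLinearMap.fst k k (Fin n → k)) w := by
        refine hasFDerivAt_fst.congr_of_eventuallyEq ?_
        filter_upwards [hWo.mem_nhds hw] with z hz
        exact hhψ _ hz
      have h3 := DFunLike.congr_fun (h1.unique h2) (1, 0)
      simp [hD] at h3
    intro y
    obtain ⟨z, hz⟩ := hs (P (y - D ((l y / l (D u)) • u)))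
    refine ⟨G z + (l y / l (D u)) • u, ?_⟩
    rw [map_add, ← eq_sub_iff_add_eq]
    refine e.injective (Prod.ext ?_ hz)
    rw [he, he, hlG]
    simp [hu]
  · change (e (f (ψ (i w.2)))).2 = y
    rw [hiw]
    exact congrArg Prod.snd hxy

theorem AnalyticAt.isBigO_sub_of_iteratedFDeriv_eq_zero {p m : ℕ} [CharP k p] (hp : p.Prime)
    {f : (Fin m → k) → (Fin r → k)} {x : Fin m → k} (hf : AnalyticAt k f x)
    (h : ∀ i, 1 ≤ i → i < p → iteratedFDeriv k i f x = 0) :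
    (fun y => f y - f x) =O[𝓝 x] fun y => ‖y - x‖ ^ p := by
  obtain ⟨q, ρ, hq⟩ := hf
  have hs (y : Fin m → k) : q.partialSum p y = f x := by
    rw [FormalMultilinearSeries.partialSum, Finset.sum_eq_single_of_mem 0
      (Finset.mem_range.2 hp.pos), hq.coeff_zero]
    intro i hi hi0
    have h1 := hq.factorial_smul y i
    rw [h i (by omega) (Finset.mem_range.1 hi), zero_apply,
      ← Nat.cast_smul_eq_nsmul k] at h1
    refine (smul_eq_zero.1 h1).resolve_left fun h0 => ?_
    rw [CharP.cast_eq_zero_iff k p, hp.dvd_factorial] at h0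
    exact absurd (Finset.mem_range.1 hi) (by omega)
  have h2 := hq.hasFPowerSeriesAt.isBigO_sub_partialSum_pow p
  simp only [hs] at h2
  have h3 : Tendsto (fun y => y - x) (𝓝 x) (𝓝 0) := by
    simpa using (continuous_sub_right x).tendsto x
  simpa [Function.comp_def] using h2.comp_tendsto h3

theorem exists_analytic_fderiv_ne_zero {m i : ℕ} {U : Set (Fin m → k)}
    {f : (Fin m → k) → (Fin r → k)} (hf : AnalyticOnNhd k f U)
    {x : Fin m → k} (hx : x ∈ U) (h : iteratedFDeriv k (i + 1) f x ≠ 0) :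
    ∃ g : (Fin m → k) → k, AnalyticAt k g x ∧ fderiv k g x ≠ 0 ∧
      ∀ y, iteratedFDeriv k i f y = 0 → g y = 0 := by
  have hd : fderiv k (iteratedFDeriv k i f) x ≠ 0 := by
    intro h0
    refine h (ContinuousMultilinearMap.ext fun w => ?_)
    rw [iteratedFDeriv_succ_apply_left, h0]
    rfl
  obtain ⟨v, hv⟩ : ∃ v, fderiv k (iteratedFDeriv k i f) x v ≠ 0 := by
    by_contra! h
    exact hd (ContinuousLinearMap.ext h)
  obtain ⟨w, hw⟩ : ∃ w, fderiv k (iteratedFDeriv k i f) x v w ≠ 0 := by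
    by_contra! h
    exact hv (ContinuousMultilinearMap.ext h)
  obtain ⟨j, hj⟩ := Function.ne_iff.1 hw
  let l := (ContinuousLinearMap.proj (R := k) (φ := fun _ : Fin r => k) j).comp
    (ContinuousMultilinearMap.apply k (fun _ : Fin i => Fin m → k) (Fin r → k) w)
  have ha := hf.iteratedFDeriv i x hx
  refine ⟨l ∘ iteratedFDeriv k i f, (l.analyticAt _).comp ha, fun h0 => hj ?_,
    fun y hy => by simp [hy]⟩
  rw [(l.hasFDerivAt.comp x ha.differentiableAt.hasFDerivAt).fderiv] at h0
  exact DFunLike.congr_fun h0 v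

theorem nullCriticalValues [IsUltrametricDist k] {p : ℕ} [CharP k p] (hp : p.Prime) (m : ℕ) :
    ∀ r : ℕ, m + 1 < p + r → NullCriticalValues k m r := by
  induction m using Nat.strong_induction_on with | _ m ih
  rintro (_ | r) hpr U f hU hf _ _ μ _
  · simp [Function.surjective_to_subsingleton]
  let κ := OuterMeasure.comap f μ.toOuterMeasure
  let C₁ := {x ∈ U | ¬ Function.Surjective (fderiv k f x)} ∩ {x | fderiv k f x ≠ 0}
  let C₂ : ℕ → Set (Fin m → k) := fun i =>
    {x ∈ U | fderiv k f x = 0 ∧ iteratedFDeriv k i f x = 0 ∧ iteratedFDeriv k (i + 1) f x ≠ 0}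
  let C₃ := {x ∈ U | ∀ i, 1 ≤ i → i < p → iteratedFDeriv k i f x = 0}
  have hC₁ : κ C₁ = 0 := by
    refine measure_null_of_locally_null _ fun x hx => ?_
    obtain ⟨n, rfl⟩ : ∃ n, m = n + 1 := Nat.exists_eq_succ_of_ne_zero (by
      rintro rfl
      exact hx.2 (Subsingleton.elim _ _))
    obtain ⟨V, hV, h0⟩ := (ih n n.lt_succ_self r (by omega)).measure_image_near_null hU hf
      hx.1.1 hx.2 μ
    refine ⟨V ∩ C₁, inter_mem (mem_nhdsWithin_of_mem_nhds hV) self_mem_nhdsWithin, ?_⟩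
    exact measure_mono_null (μ := κ) (Set.inter_subset_inter_right _ Set.inter_subset_left) h0
  have hC₂ (i : ℕ) : κ (C₂ i) = 0 := by
    refine measure_null_of_locally_null _ fun x hx => ?_
    obtain ⟨g, hg, hgd, hg0⟩ := exists_analytic_fderiv_ne_zero hf hx.1 hx.2.2.2
    obtain ⟨n, rfl⟩ : ∃ n, m = n + 1 := Nat.exists_eq_succ_of_ne_zero (by
      rintro rfl
      exact hgd (Subsingleton.elim _ _))
    obtain ⟨V, hV, h0⟩ := (ih n n.lt_succ_self (r + 1) (by omega)).measure_image_zero_locus_null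
      r.succ_ne_zero hU hf hx.1 hg hgd μ
    refine ⟨V ∩ C₂ i, inter_mem (mem_nhdsWithin_of_mem_nhds hV) self_mem_nhdsWithin, ?_⟩
    exact measure_mono_null (μ := κ) (t := V ∩ {x | g x = 0 ∧ fderiv k f x = 0})
      (fun y hy => ⟨hy.1, hg0 y hy.2.2.2.1, hy.2.2.1⟩) h0
  have hC₃ : κ C₃ = 0 :=
    measure_image_null_of_isBigO_pi (s := p) (by nlinarith [hp.two_le])
      (fun x hx => (hf x hx.1).isBigO_sub_of_iteratedFDeriv_eq_zero hp hx.2) μ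
  have hsub : {x ∈ U | ¬ Function.Surjective (fderiv k f x)} ⊆ C₁ ∪ ((⋃ i, C₂ i) ∪ C₃) := by
    intro x hx
    by_cases hd : fderiv k f x = 0
    · right
      by_cases h3 : x ∈ C₃
      · exact Or.inr h3
      · left
        have hex : ∃ i, 1 ≤ i ∧ iteratedFDeriv k i f x ≠ 0 := by
          by_contra! h
          exact h3 ⟨hx.1, fun i hi _ => h i hi⟩
        classical
        obtain ⟨h1, h2⟩ := Nat.find_spec hex
        have hmin := fun j => Nat.find_min hex (m := j)
        generalize Nat.find hex = i at h1 h2 hmin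
        obtain ⟨i, rfl⟩ : ∃ j, i = j + 1 := ⟨i - 1, by omega⟩
        have hi : i ≠ 0 := by
          rintro rfl
          rw [← norm_ne_zero_iff, zero_add, norm_iteratedFDeriv_one, hd] at h2
          exact h2 norm_zero
        refine Set.mem_iUnion.2 ⟨i, hx.1, hd, ?_, h2⟩
        by_contra h
        exact hmin i i.lt_succ_self ⟨Nat.one_le_iff_ne_zero.2 hi, h⟩
    · exact Or.inl ⟨hx, hd⟩
  exact measure_mono_null (μ := κ) hsub
    (measure_union_null hC₁ (measure_union_null (measure_iUnion_null hC₂) hC₃))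

end Sard

/-- Let `k` be a non-archimedean local field of characteristic
`p > 0`, `U ⊆ k^m` open, and `f : U → k^r` analytic.  Let `C` be the set of
points of `U` where the derivative of `f` is not surjective.  If
`p > m - r + 1` then `f(C)` has Haar measure zero in `k^r`. -/
theorem stmt2 {k : Type*} [NontriviallyNormedField k] [IsUltrametricDist k]
    [LocallyCompactSpace k] [CompleteSpace k] {p : ℕ} [CharP k p] (hp : 0 < p)
    {m r : ℕ} (U : Set (Fin m → k)) (hU : IsOpen U)
    (f : (Fin m → k) → (Fin r → k)) (hf : AnalyticOnNhd k f U)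
    (hpr : m - r + 1 < p)
    [MeasurableSpace (Fin r → k)] [BorelSpace (Fin r → k)]
    (μ : Measure (Fin r → k)) [μ.IsAddHaarMeasure] :
    μ (f '' {x ∈ U | ¬ Function.Surjective (fderiv k f x)}) = 0 := by
  have := ProperSpace.of_locallyCompactSpace k (E := k)
  have hp' : p.Prime := (CharP.char_is_prime_or_zero k p).resolve_right hp.ne'
  have := hp'.two_le
  exact nullCriticalValues hp' m r (by omega) U f hU hf μ
end

section
/- Let k be a local field and f = (f₁,…,f_r) : k^m → k^r a polynomial map with df₁ ∧ … ∧ df_r not identically zero. Let ω ⊆ k^r be an open set with compact closure such that the closure of ω is disjoint from the closure (in the k-topology) of the set CV(f) of critical values of f; in particular every point of the closure of ω is a non-critical value. Then there exist constants C > 0 and γ ≥ 0 such that ‖∇_r f(x)‖ ≥ C/‖x‖^γ for all c ∈ ω and all x ∈ L_c with ‖x‖ ≥ 1. -/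
open MvPolynomial

section

open IsLocalRing Filter Topology

universe u

/-- A residue field embedding of a purely transcendental subfield lifts to the local ring. -/
theorem exists_lift_adjoin_of_algebraicIndependent {k A L ι : Type*} [Field k] [CommRing A]
    [IsLocalRing A] [Algebra k A] [Field L] [Algebra k L] {x : ι → L}
    (hx : AlgebraicIndependent k x) (τ : L →ₐ[k] ResidueField A) :
    ∃ σ : IntermediateField.adjoin k (Set.range x) →ₐ[k] A,
      ∀ z, residue A (σ z) = τ z := by
  choose a ha using fun i => residue_surjective (τ (x i))
  have key (q : MvPolynomial ι k) : residue A (aeval a q) = τ (aeval x q) := by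
    have : (IsScalarTower.toAlgHom k A (ResidueField A)).comp (aeval a) = τ.comp (aeval x) := by
      ext i
      simpa using ha i
    exact DFunLike.congr_fun this q
  have hunit (q : nonZeroDivisors (MvPolynomial ι k)) : IsUnit (aeval a (q : MvPolynomial ι k)) := by
    rw [← residue_ne_zero_iff_isUnit, key, map_ne_zero]
    exact fun h => nonZeroDivisors.ne_zero q.2 ((injective_iff_map_eq_zero _).1 hx _ h)
  let ρ : FractionRing (MvPolynomial ι k) →ₐ[k] A := IsLocalization.liftAlgHom hunit
  refine ⟨ρ.comp hx.aevalEquivField.symm.toAlgHom, fun z => ?_⟩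
  obtain ⟨w, rfl⟩ := hx.aevalEquivField.surjective z
  have : (IsScalarTower.toAlgHom k A (ResidueField A)).comp ρ =
      (τ.comp (IntermediateField.val _)).comp hx.aevalEquivField.toAlgHom := by
    apply AlgHom.coe_ringHom_injective
    apply IsLocalization.ringHom_ext (nonZeroDivisors (MvPolynomial ι k))
    ext q
    · simpa [ρ] using (IsScalarTower.algebraMap_apply k A (ResidueField A) q).symm
    · simp [ρ, ha]
  simpa using DFunLike.congr_fun this w

theorem exists_lift_of_isSeparable {A K L : Type*} [Field K] [CommRing A]
    [HenselianLocalRing A] [Algebra K A] [Field L] [Algebra K L] [FiniteDimensional K L]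
    [Algebra.IsSeparable K L] (τ : L →ₐ[K] ResidueField A) :
    ∃ σ : L →ₐ[K] A, ∀ z, residue A (σ z) = τ z := by
  obtain ⟨α, hα⟩ := Field.exists_primitive_element K L
  have hint : IsIntegral K α := Algebra.IsIntegral.isIntegral α
  let pb : PowerBasis K L := PowerBasis.ofAdjoinEqTop hint <| by
    rw [← IntermediateField.adjoin_simple_toSubalgebra_of_isAlgebraic hint.isAlgebraic, hα,
      IntermediateField.top_toSubalgebra]
  have hgen : pb.gen = α := by simp [pb]
  have hsep : (minpoly K α).Separable := Algebra.IsSeparable.isSeparable K α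
  obtain ⟨a, ha, haτ⟩ := (((HenselianLocalRing.TFAE A).out 0 1 :) :
    HenselianLocalRing A ↔ _).1 inferInstance
    ((minpoly K α).map (algebraMap K A)) ((minpoly.monic hint).map _) (τ α)
    (by rw [Polynomial.aeval_map_algebraMap, Polynomial.aeval_algHom_apply, minpoly.aeval, map_zero])
    (by
      rw [Polynomial.derivative_map, Polynomial.aeval_map_algebraMap, Polynomial.aeval_algHom_apply,
        map_ne_zero]
      exact hsep.aeval_derivative_ne_zero (minpoly.aeval K α))
  have hroot : Polynomial.aeval a (minpoly K pb.gen) = 0 := by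
    rwa [hgen, Polynomial.aeval_def, Polynomial.eval₂_eq_eval_map]
  have hτ : (IsScalarTower.toAlgHom K A (ResidueField A)).comp (pb.lift a hroot) = τ := by
    apply pb.algHom_ext
    change residue A (pb.lift a hroot pb.gen) = τ pb.gen
    rw [pb.lift_gen, hgen, haτ]
  exact ⟨pb.lift a hroot, fun z => DFunLike.congr_fun hτ z⟩

theorem exists_lift_of_separablyGenerated {k A L ι : Type*} [Field k] [CommRing A]
    [HenselianLocalRing A] [Algebra k A] [Field L] [Algebra k L] [Algebra.EssFiniteType k L]
    {x : ι → L} (hx : AlgebraicIndependent k x)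
    [Algebra.IsSeparable (IntermediateField.adjoin k (Set.range x)) L]
    (τ : L →ₐ[k] ResidueField A) :
    ∃ σ : L →ₐ[k] A, ∀ z, residue A (σ z) = τ z := by
  set K := IntermediateField.adjoin k (Set.range x)
  obtain ⟨σ₀, hσ₀⟩ := exists_lift_adjoin_of_algebraicIndependent hx τ
  let _ : Algebra K A := σ₀.toRingHom.toAlgebra
  have : IsScalarTower k K A := IsScalarTower.of_algebraMap_eq fun c => (σ₀.commutes c).symm
  have : Algebra.EssFiniteType K L := Algebra.EssFiniteType.of_comp k K L
  have : FiniteDimensional K L := Algebra.finite_of_essFiniteType_of_isAlgebraic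
  let τ' : L →ₐ[K] ResidueField A := { τ with commutes' := fun z => (hσ₀ z).symm }
  obtain ⟨σ, hσ⟩ := exists_lift_of_isSeparable τ'
  exact ⟨σ.restrictScalars k, hσ⟩

/-- If the residue field of a Henselian local algebra is separable over the base field (in the sense
of Mac Lane's criterion), residue solutions of polynomial systems lift to exact solutions. -/
theorem exists_lift_of_linearIndepOn_pow {k σ : Type*} {A : Type u} [Field k] [CommRing A]
    [HenselianLocalRing A] [Algebra k A] [Finite σ]
    (H : ∀ p : ℕ, p.Prime → CharP k p → ∀ {ι : Type u} [Finite ι] (a : ι → ResidueField A),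
      LinearIndependent k a → LinearIndependent k fun i => a i ^ p)
    (ξ : σ → A) :
    ∃ y : σ → A, (∀ i, y i - ξ i ∈ maximalIdeal A) ∧
      ∀ g : MvPolynomial σ k, aeval ξ g ∈ maximalIdeal A → aeval y g = 0 := by
  let L := IntermediateField.adjoin k (Set.range fun i => residue A (ξ i))
  have : Algebra.EssFiniteType k L :=
    IntermediateField.essFiniteType_iff.2 (IntermediateField.fg_adjoin_of_finite (Set.finite_range _))
  obtain ⟨s, hs, hsep⟩ : ∃ s : Finset L, IsTranscendenceBasis k ((↑) : s → L) ∧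
      Algebra.IsSeparable (IntermediateField.adjoin k (s : Set L)) L := by
    obtain _ | ⟨p, hp, hpk⟩ := CharP.exists' k
    · exact exists_isTranscendenceBasis_and_isSeparable_of_perfectField k L
    · have : ExpChar k p := .prime hp.out
      refine exists_isTranscendenceBasis_and_isSeparable_of_linearIndepOn_pow_of_essFiniteType
        p hp.out fun s hs ↦ ?_
      have h := H p hp.out hpk (fun i : s => L.val i)
        (LinearIndependent.map' hs L.val.toLinearMap (LinearMap.ker_eq_bot.2 L.val.injective))
      refine LinearIndependent.of_comp L.val.toLinearMap ?_
      simpa [Function.comp_def] using h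
  have hr : Set.range ((↑) : s → L) = (s : Set L) := Subtype.range_coe
  rw [← hr] at hsep
  obtain ⟨φ, hφ⟩ := exists_lift_of_separablyGenerated hs.1 L.val
  let η : σ → L := fun i => ⟨residue A (ξ i), IntermediateField.subset_adjoin _ _ ⟨i, rfl⟩⟩
  refine ⟨fun i => φ (η i), fun i => ?_, fun g hg => ?_⟩
  · rw [← residue_eq_zero_iff, map_sub, hφ, sub_eq_zero]; rfl
  · have h1 : aeval (fun i => φ (η i)) g = φ (aeval η g) := by
      have : aeval (fun i => φ (η i)) = φ.comp (aeval η) := by ext i; simp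
      exact DFunLike.congr_fun this g
    have h2 : L.val (aeval η g) = residue A (aeval ξ g) := by
      have : L.val.comp (aeval η) = (IsScalarTower.toAlgHom k A (ResidueField A)).comp (aeval ξ) := by
        ext i; simp [η]
      exact DFunLike.congr_fun this g
    rw [(residue_eq_zero_iff _).2 hg, map_eq_zero] at h2
    rw [h1, h2, map_zero]

/-- A local ring is Henselian once equations `1 + y + ∑ dⱼ y ^ (j + 2) = 0` with all `dⱼ` in the
maximal ideal are solvable. -/
theorem henselianLocalRing_of_exists_root {A : Type*} [CommRing A] [IsLocalRing A]
    (H : ∀ (D : ℕ) (d : Fin D → A), (∀ j, d j ∈ maximalIdeal A) →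
      ∃ y : A, 1 + y + ∑ j, d j * y ^ (j + 2 : ℕ) = 0) :
    HenselianLocalRing A where
  is_henselian f _ a₀ h₀ h₁ := by
    obtain ⟨u, hu⟩ := h₁
    set g := Polynomial.taylor a₀ f with hg
    have hg0 : g.coeff 0 = f.eval a₀ := Polynomial.taylor_coeff_zero ..
    have hg1 : g.coeff 1 = u := by rw [hu]; exact Polynomial.taylor_coeff_one ..
    set e : A := f.eval a₀ * ↑u⁻¹ with he
    have hem : e ∈ maximalIdeal A := Ideal.mul_mem_right _ _ h₀
    obtain ⟨y, hy⟩ := H g.natDegree (fun j => g.coeff (j + 2) * ↑u⁻¹ * e ^ (j + 1 : ℕ)) fun j =>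
      Ideal.mul_mem_left _ _ (Ideal.pow_mem_of_mem _ hem _ (Nat.succ_pos _))
    have heu : f.eval a₀ = e * u := by simp [he, mul_assoc]
    refine ⟨a₀ + e * y, ?_, by simpa using Ideal.mul_mem_right _ _ hem⟩
    have h : f.eval (a₀ + e * y) = g.eval (e * y) := by
      rw [hg, Polynomial.taylor_eval, add_comm]
    rw [Polynomial.IsRoot, h, Polynomial.eval_eq_sum_range' (n := g.natDegree + 2) (by omega),
      Finset.sum_range_succ', Finset.sum_range_succ', ← Fin.sum_univ_eq_sum_range
        (fun j => g.coeff (j + 1 + 1) * (e * y) ^ (j + 1 + 1))]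
    have h2 : ∑ j : Fin g.natDegree, g.coeff (j + 1 + 1) * (e * y) ^ (j + 1 + 1 : ℕ) =
        e * u * ∑ j : Fin g.natDegree, g.coeff (j + 2) * ↑u⁻¹ * e ^ (j + 1 : ℕ) * y ^ (j + 2 : ℕ) := by
      rw [Finset.mul_sum]
      refine Finset.sum_congr rfl fun j _ => ?_
      linear_combination (-g.coeff (j + 2) * e ^ (j + 2 : ℕ) * y ^ (j + 2 : ℕ)) * u.mul_inv
    rw [h2, hg0, zero_add, hg1, heu]
    linear_combination e * u * hy

theorem eventually_exists_root {k : Type*} [NontriviallyNormedField k] [CompleteSpace k] (D : ℕ) :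
    ∀ᶠ d : Fin D → k in 𝓝 0, ∃ y : k, ‖y‖ ≤ 2 ∧ 1 + y + ∑ j, d j * y ^ (j + 2 : ℕ) = 0 := by
  let F : (Fin D → k) × k → (Fin D → k) × k :=
    fun z => (z.1, 1 + z.2 + ∑ j, z.1 j * z.2 ^ (j + 2 : ℕ))
  let L : (Fin D → k) × k →L[k] k := ContinuousLinearMap.snd k _ k +
    ∑ j : Fin D, (-1 : k) ^ (j + 2 : ℕ) •
      (ContinuousLinearMap.proj j).comp (ContinuousLinearMap.fst k (Fin D → k) k)
  have hF : HasStrictFDerivAt F ((ContinuousLinearMap.fst k _ k).prod L) (0, -1) := by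
    refine hasStrictFDerivAt_fst.prodMk ?_
    refine (hasStrictFDerivAt_snd.const_add 1).add ?_
    refine HasStrictFDerivAt.fun_sum fun j _ => ?_
    have h1 : HasStrictFDerivAt (fun z : (Fin D → k) × k => z.1 j)
        ((ContinuousLinearMap.proj j).comp (ContinuousLinearMap.fst k (Fin D → k) k)) (0, -1) :=
      ((ContinuousLinearMap.proj (R := k) (φ := fun _ : Fin D => k) j).comp
        (ContinuousLinearMap.fst k (Fin D → k) k)).hasStrictFDerivAt
    have h2 : HasStrictFDerivAt (fun z : (Fin D → k) × k => z.1 j * z.2 ^ (j + 2 : ℕ)) _ _ :=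
      h1.mul ((hasStrictFDerivAt_snd (𝕜 := k) (p := ((0 : Fin D → k), (-1 : k)))).pow
      (j + 2 : ℕ))
    refine h2.congr_fderiv ?_
    ext <;> simp
  have hsurj : ((ContinuousLinearMap.fst k _ k).prod L).range = ⊤ := by
    rw [LinearMap.range_eq_top]
    rintro ⟨a, b⟩
    refine ⟨(a, b - ∑ j : Fin D, (-1) ^ (j + 2 : ℕ) * a j), ?_⟩
    simp [L]
  have hmap := hF.map_nhds_eq_of_surj hsurj
  have hF0 : F (0, -1) = (0, 0) := by simp [F]
  rw [hF0] at hmap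
  have hball : ∀ᶠ z : (Fin D → k) × k in 𝓝 (0, -1), ‖z.2‖ ≤ 2 := by
    have : Tendsto (fun z : (Fin D → k) × k => ‖z.2‖) (𝓝 (0, -1)) (𝓝 1) := by
      have h : ContinuousAt (fun z : (Fin D → k) × k => ‖z.2‖) (0, -1) := by fun_prop
      simpa [ContinuousAt] using h
    exact (this.eventually_lt_const one_lt_two).mono fun _ => le_of_lt
  have himg : ∀ᶠ w in 𝓝 ((0 : Fin D → k), (0 : k)), ∃ z, ‖z.2‖ ≤ 2 ∧ F z = w := by
    rw [← hmap]
    exact eventually_map.2 (hball.mono fun z hz => ⟨z, hz, rfl⟩)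
  have hc : Tendsto (fun d : Fin D → k => (d, (0 : k))) (𝓝 0) (𝓝 (0, 0)) :=
    (Continuous.prodMk_left 0).tendsto' _ _ rfl
  filter_upwards [hc.eventually himg] with d ⟨z, hz, hzd⟩
  obtain ⟨rfl, h2⟩ := Prod.mk.inj hzd
  exact ⟨z.2, hz, h2⟩

/-- An anisotropic diagonal form over a locally compact field is bounded below. -/
theorem exists_pos_mul_pow_le_norm_sum {k : Type*} [NontriviallyNormedField k]
    [LocallyCompactSpace k] {q p : ℕ} (hp : p ≠ 0) (b : Fin q → k)
    (hb : ∀ x : Fin q → k, ∑ j, b j * x j ^ p = 0 → x = 0) :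
    ∃ δ > 0, ∀ x : Fin q → k, δ * ‖x‖ ^ p ≤ ‖∑ j, b j * x j ^ p‖ := by
  have : ProperSpace k := ProperSpace.of_locallyCompactSpace k
  obtain ⟨c, hc⟩ := NormedField.exists_one_lt_norm k
  have hc0 : 0 < ‖c‖ := one_pos.trans hc
  have hcomp : IsCompact {x : Fin q → k | 1 ≤ ‖x‖ ∧ ‖x‖ ≤ ‖c‖} := by
    refine (isCompact_closedBall (0 : Fin q → k) ‖c‖).of_isClosed_subset ?_ fun x hx => by
      simpa using hx.2
    exact (isClosed_le continuous_const continuous_norm).inter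
      (isClosed_le continuous_norm continuous_const)
  obtain ⟨δ, hδ, hmin⟩ := hcomp.exists_forall_le' (f := fun x => ‖∑ j, b j * x j ^ p‖) (a := 0)
    (by fun_prop) fun x hx => norm_pos_iff.2 fun h => by
      have := hb x h
      norm_num [this] at hx
  refine ⟨δ / ‖c‖ ^ p, by positivity, fun x => ?_⟩
  rcases eq_or_ne x 0 with rfl | hx
  · simp [hp]
  · obtain ⟨d, hd, h1, h2, -⟩ := rescale_to_shell hc hc0 hx
    rw [div_self hc0.ne'] at h2
    have h3 := hmin (d • x) ⟨h2, h1.le⟩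
    have h4 : ∑ j, b j * (d • x) j ^ p = d ^ p * ∑ j, b j * x j ^ p := by
      rw [Finset.mul_sum]
      refine Finset.sum_congr rfl fun j _ => ?_
      simp [mul_pow]; ring
    simp only [h4, norm_mul, norm_pow] at h3
    rw [norm_smul] at h1
    have hd0 : 0 < ‖d‖ := norm_pos_iff.2 hd
    have h5 : ‖d‖ ^ p * ‖x‖ ^ p ≤ ‖c‖ ^ p := by
      rw [← mul_pow]; gcongr
    rw [div_mul_eq_mul_div, div_le_iff₀ (by positivity)]
    refine le_of_mul_le_mul_left ?_ (pow_pos hd0 p)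
    calc ‖d‖ ^ p * (δ * ‖x‖ ^ p) = δ * (‖d‖ ^ p * ‖x‖ ^ p) := by ring
      _ ≤ δ * ‖c‖ ^ p := by gcongr
      _ ≤ (‖d‖ ^ p * ‖∑ j, b j * x j ^ p‖) * ‖c‖ ^ p := by gcongr
      _ = _ := by ring

theorem linearIndependent_pow_of_forall_sum_mul_pow {k κ ι : Type*} [Field k] [Field κ]
    [Algebra k κ] [Finite ι] {p : ℕ} (hp : p.Prime) [CharP k p]
    (H : ∀ (q : ℕ) (b : Fin q → k), (∀ x : Fin q → k, ∑ j, b j * x j ^ p = 0 → x = 0) →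
      ∀ w : Fin q → κ, ∑ j, algebraMap k κ (b j) * w j ^ p = 0 → w = 0)
    {a : ι → κ} (ha : LinearIndependent k a) : LinearIndependent k fun i => a i ^ p := by
  have := Fintype.ofFinite ι
  have : Fact p.Prime := ⟨hp⟩
  have : CharP κ p := charP_of_injective_algebraMap (algebraMap k κ).injective p
  rw [Fintype.linearIndependent_iff]
  intro c hc
  let F : Subfield k := (frobenius k p).fieldRange
  let V : Submodule F k := Submodule.span F (Set.range c)
  have : Module.Finite F V := Module.Finite.span_of_finite F (Set.finite_range c)
  let B := Module.finBasis F V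
  let C : ι → V := fun i => ⟨c i, Submodule.subset_span ⟨i, rfl⟩⟩
  choose v hv using fun i j => (B.repr (C i) j).2
  have hcv (i : ι) : c i = ∑ j, v i j ^ p * (B j : k) := by
    have h := congrArg (Subtype.val) (B.sum_repr (C i))
    rw [← show ((C i : V) : k) = c i from rfl, ← h, AddSubmonoidClass.coe_finsetSum]
    refine Finset.sum_congr rfl fun j _ => ?_
    rw [← frobenius_def, hv]
    rfl
  have hB (x : Fin (Module.finrank F V) → k) (hx : ∑ j, (B j : k) * x j ^ p = 0) : x = 0 := by
    have hli : LinearIndependent F fun j => (B j : k) :=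
      B.linearIndependent.map' V.subtype (Submodule.ker_subtype V)
    rw [Fintype.linearIndependent_iff] at hli
    ext j
    have h := hli (fun j => ⟨x j ^ p, x j, rfl⟩) (by
      rw [← hx]
      exact Finset.sum_congr rfl fun j _ => mul_comm _ _) j
    exact eq_zero_of_pow_eq_zero (congrArg Subtype.val h)
  have hw := H _ (fun j => (B j : k)) hB (fun j => ∑ i, v i j • a i) (by
    simp_rw [sum_pow_char, smul_pow, Finset.mul_sum]
    rw [Finset.sum_comm, ← hc]
    refine Finset.sum_congr rfl fun i _ => ?_
    rw [hcv i, Finset.sum_smul]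
    refine Finset.sum_congr rfl fun j _ => ?_
    simp only [Algebra.smul_def, map_mul]
    ring)
  intro i
  rw [hcv i]
  refine Finset.sum_eq_zero fun j _ => ?_
  rw [Fintype.linearIndependent_iff.1 ha (fun i => v i j) (congrFun hw j) i, zero_pow hp.ne_zero,
    zero_mul]

theorem Matrix.exists_submatrix_det_ne_zero_of_rank_eq {k : Type*} [Field k] {m r : ℕ}
    (M : Matrix (Fin r) (Fin m) k) (h : M.rank = r) :
    ∃ ι : Fin r ↪ Fin m, (Matrix.of fun a b => M a (ι b) : Matrix (Fin r) (Fin r) k).det ≠ 0 := by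
  obtain ⟨κ, a, ha, hspan, hli⟩ := exists_linearIndependent' k M.col
  have : Finite κ := Finite.of_injective a ha
  have := Fintype.ofFinite κ
  have hcard : Fintype.card κ = r := by
    rw [← finrank_span_eq_card hli, hspan, ← Matrix.rank_eq_finrank_span_cols, h]
  let e : Fin r ≃ κ := (Fintype.equivFinOfCardEq hcard).symm
  refine ⟨e.toEmbedding.trans ⟨a, ha⟩, ?_⟩
  have h2 := hli.comp e e.injective
  have h3 := (Matrix.linearIndependent_cols_iff_isUnit (A := Matrix.of fun a b =>
    M a (e.toEmbedding.trans ⟨_, ha⟩ b))).1 h2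
  exact ((Matrix.isUnit_iff_isUnit_det _).1 h3).ne_zero

namespace Filter.Germ

variable {α : Type*}

/-- The valuation subring of germs bounded by a power of the gauge `Λ`. -/
def moderate (k : Type*) [NontriviallyNormedField k] (U : Ultrafilter α) {Λ : α → ℝ}
    (hΛ : ∀ n, 2 ≤ Λ n) : ValuationSubring (Germ (U : Filter α) k) where
  carrier := {a | ∃ N : ℕ, LiftRel (fun x l => ‖x‖ ≤ l ^ N) a (Λ : Germ (U : Filter α) ℝ)}
  mul_mem' {a b} := by
    refine inductionOn₂ a b fun f g => ?_
    rintro ⟨M, hM⟩ ⟨N, hN⟩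
    refine ⟨M + N, ?_⟩
    rw [← coe_mul]
    simp only [liftRel_coe] at *
    filter_upwards [hM, hN] with n h1 h2
    rw [Pi.mul_apply, norm_mul, pow_add]
    have : 0 ≤ Λ n := by linarith [hΛ n]
    gcongr
  one_mem' := ⟨0, (liftRel_coe (f := fun _ => (1 : k))).2 (by simp)⟩
  add_mem' {a b} := by
    refine inductionOn₂ a b fun f g => ?_
    rintro ⟨M, hM⟩ ⟨N, hN⟩
    refine ⟨M + N + 1, ?_⟩
    rw [← coe_add]
    simp only [liftRel_coe] at *
    filter_upwards [hM, hN] with n h1 h2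
    have h := hΛ n
    have h3 : Λ n ^ M ≤ Λ n ^ (M + N) := pow_le_pow_right₀ (by linarith) (by omega)
    have h4 : Λ n ^ N ≤ Λ n ^ (M + N) := pow_le_pow_right₀ (by linarith) (by omega)
    have h5 : 0 < Λ n ^ (M + N) := pow_pos (by linarith) _
    calc ‖f n + g n‖ ≤ ‖f n‖ + ‖g n‖ := norm_add_le _ _
      _ ≤ Λ n ^ (M + N) * 2 := by linarith
      _ ≤ Λ n ^ (M + N + 1) := by rw [pow_succ]; gcongr
  zero_mem' := ⟨0, (liftRel_coe (f := fun _ => (0 : k))).2 (by simp)⟩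
  neg_mem' {a} := by
    refine inductionOn a fun f => ?_
    rintro ⟨N, hN⟩
    refine ⟨N, ?_⟩
    rw [← coe_neg]
    simp only [liftRel_coe] at *
    simpa using hN
  mem_or_inv_mem' a := by
    refine inductionOn a fun f => ?_
    refine (U.em fun n => ‖f n‖ ≤ 1).imp (fun h => ⟨0, by simpa using h⟩) fun h => ⟨0, ?_⟩
    rw [← coe_inv]
    simp only [liftRel_coe]
    filter_upwards [h] with n hn
    simpa using inv_le_one_of_one_le₀ (not_le.1 hn).le

variable {k : Type*} [NontriviallyNormedField k] {U : Ultrafilter α} {Λ : α → ℝ} {hΛ : ∀ n, 2 ≤ Λ n}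

theorem coe_mem_moderate {f : α → k} :
    (f : Germ (U : Filter α) k) ∈ moderate k U hΛ ↔ ∃ N : ℕ, ∀ᶠ n in U, ‖f n‖ ≤ Λ n ^ N :=
  Iff.rfl

theorem mem_maximalIdeal_moderate_iff {f : α → k}
    (hf : (f : Germ (U : Filter α) k) ∈ moderate k U hΛ) :
    (⟨f, hf⟩ : moderate k U hΛ) ∈ maximalIdeal (moderate k U hΛ) ↔
      ∀ N : ℕ, ∀ᶠ n in U, ‖f n‖ * Λ n ^ N < 1 := by
  rw [ValuationSubring.valuation_lt_one_iff, ← ValuationSubring.mem_nonunits_iff,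
    ValuationSubring.mem_nonunits_iff_or, ← coe_inv, coe_mem_moderate]
  constructor
  · rintro (h | h) N
    · filter_upwards [coe_eq.1 (h.trans coe_zero.symm)] with n hn
      simp [hn]
    · refine (U.em _).resolve_right fun h2 => h ⟨N, ?_⟩
      filter_upwards [h2] with n hn
      rw [not_lt] at hn
      have h0 : 0 < ‖f n‖ := by
        by_contra h0
        rw [le_antisymm (not_lt.1 h0) (norm_nonneg _)] at hn
        norm_num at hn
      rwa [Pi.inv_apply, norm_inv, inv_le_iff_one_le_mul₀' h0]
  · intro h
    by_contra! h2
    obtain ⟨hne, N, hN⟩ := h2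
    have hne' : ∀ᶠ n in U, ¬ f n = 0 := by
      rw [Ultrafilter.eventually_not]
      exact fun h => hne ((coe_eq.2 h).trans coe_zero)
    have hF : ∀ᶠ _ in (U : Filter α), False := by
      filter_upwards [h N, hN, hne'] with n h1 h2 h3
      rw [Pi.inv_apply, norm_inv, inv_le_iff_one_le_mul₀' (norm_pos_iff.2 h3)] at h2
      linarith
    exact hF.exists.elim fun _ h => h

theorem tendsto_zero_of_mem_maximalIdeal {f : α → k}
    {hf : (f : Germ (U : Filter α) k) ∈ moderate k U hΛ}
    (h : (⟨f, hf⟩ : moderate k U hΛ) ∈ maximalIdeal (moderate k U hΛ)) :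
    Tendsto f U (𝓝 0) := by
  rw [NormedAddGroup.tendsto_nhds_zero]
  intro ε hε
  obtain ⟨N, hN⟩ := pow_unbounded_of_one_lt ε⁻¹ one_lt_two
  filter_upwards [(mem_maximalIdeal_moderate_iff hf).1 h N] with n hn
  have h1 : ε⁻¹ < Λ n ^ N := hN.trans_le (pow_le_pow_left₀ zero_le_two (hΛ n) N)
  have h2 : ‖f n‖ * ε⁻¹ < 1 := lt_of_le_of_lt (by gcongr) hn
  rwa [← div_eq_mul_inv, div_lt_one hε] at h2

theorem exists_eq_coe_of_moderate {σ : Type*} (y : σ → moderate k U hΛ) :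
    ∃ (Y : α → σ → k) (hY : ∀ i, ((fun n => Y n i : α → k) : Germ (U : Filter α) k) ∈
      moderate k U hΛ), y = fun i => ⟨_, hY i⟩ := by
  choose Y hY using fun i => Quotient.exists_rep (y i).1
  have hY' (i : σ) : ((Y i : α → k) : Germ (U : Filter α) k) = (y i).1 := hY i
  exact ⟨fun n i => Y i n, fun i => hY' i ▸ (y i).2, funext fun i => Subtype.ext (hY' i).symm⟩

theorem henselianLocalRing_moderate [CompleteSpace k] :
    HenselianLocalRing (moderate k U hΛ) := by
  refine henselianLocalRing_of_exists_root fun D d hd => ?_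
  obtain ⟨δ, hδ, rfl⟩ := exists_eq_coe_of_moderate d
  have hδ0 : Tendsto δ U (𝓝 0) :=
    tendsto_pi_nhds.2 fun j => tendsto_zero_of_mem_maximalIdeal (hd j)
  have hroot := hδ0.eventually (eventually_exists_root D)
  choose! y hy hy0 using fun n (h : ∃ y : k, ‖y‖ ≤ 2 ∧ 1 + y + ∑ j, δ n j * y ^ (j + 2 : ℕ) = 0) => h
  have hmem : (y : Germ (U : Filter α) k) ∈ moderate k U hΛ :=
    coe_mem_moderate.2 ⟨1, hroot.mono fun n hn => by simpa using (hy n hn).trans (hΛ n)⟩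
  refine ⟨⟨y, hmem⟩, Subtype.ext ?_⟩
  have h : ((1 + y + ∑ j, (fun n => δ n j) * y ^ (j + 2 : ℕ) : α → k) : Germ (U : Filter α) k) =
      ((0 : α → k) : Germ (U : Filter α) k) :=
    coe_eq.2 <| hroot.mono fun n hn => by simpa using hy0 n hn
  change coeRingHom (U : Filter α) _ = coeRingHom (U : Filter α) _ at h
  simp only [map_add, map_one, map_sum, map_mul, map_pow, map_zero] at h
  push_cast
  exact h

/-- Constant germs are moderate. -/
noncomputable instance : Algebra k (moderate k U hΛ) :=
  RingHom.toAlgebra <|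
    ((coeRingHom (U : Filter α)).comp (Pi.constRingHom α k)).codRestrict (moderate k U hΛ).toSubring
      fun c => by
        obtain ⟨N, hN⟩ := pow_unbounded_of_one_lt ‖c‖ one_lt_two
        exact coe_mem_moderate.2 ⟨N, .of_forall fun n =>
          hN.le.trans (pow_le_pow_left₀ zero_le_two (hΛ n) N)⟩

theorem coe_algebraMap_moderate (c : k) :
    (algebraMap k (moderate k U hΛ) c : Germ (U : Filter α) k) = ((fun _ => c : α → k) : Germ _ k) :=
  rfl

theorem aeval_moderate {σ : Type*} {Y : α → σ → k}
    (hY : ∀ i, ((fun n => Y n i : α → k) : Germ (U : Filter α) k) ∈ moderate k U hΛ)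
    (g : MvPolynomial σ k) :
    (aeval (fun i => (⟨_, hY i⟩ : moderate k U hΛ)) g : Germ (U : Filter α) k) =
      ((fun n => eval (Y n) g : α → k) : Germ (U : Filter α) k) := by
  induction g using MvPolynomial.induction_on with
  | C c => simp [coe_algebraMap_moderate]
  | add p q hp hq =>
    simp only [map_add]
    push_cast
    rw [hp, hq]
    rfl
  | mul_X p i hp =>
    simp only [map_mul, aeval_X, eval_X]
    push_cast
    rw [hp]
    rfl

/-- Diagonal forms anisotropic over `k` stay anisotropic over the residue field of moderate germs. -/
theorem eq_zero_of_sum_mul_pow_eq_zero [LocallyCompactSpace k] {p q : ℕ} (hp : p ≠ 0)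
    (b : Fin q → k) (hb : ∀ x : Fin q → k, ∑ j, b j * x j ^ p = 0 → x = 0)
    (w : Fin q → ResidueField (moderate k U hΛ))
    (hw : ∑ j, algebraMap k _ (b j) * w j ^ p = 0) : w = 0 := by
  choose y hy using fun j => residue_surjective (w j)
  obtain ⟨Y, hY, rfl⟩ := exists_eq_coe_of_moderate y
  let g : MvPolynomial (Fin q) k := ∑ j, C (b j) * X j ^ p
  have hg : aeval (fun i => (⟨_, hY i⟩ : moderate k U hΛ)) g ∈
      maximalIdeal (moderate k U hΛ) := by
    rw [← residue_eq_zero_iff, ← hw]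
    simp only [g, map_sum, map_mul, map_pow, aeval_X, hy, aeval_C]
    rfl
  have hmem : ((fun n => eval (Y n) g : α → k) : Germ (U : Filter α) k) ∈ moderate k U hΛ :=
    aeval_moderate hY g ▸ (aeval (fun i => (⟨_, hY i⟩ : moderate k U hΛ)) g).2
  rw [show aeval (fun i => (⟨_, hY i⟩ : moderate k U hΛ)) g = ⟨_, hmem⟩ from
    Subtype.ext (aeval_moderate hY g), mem_maximalIdeal_moderate_iff] at hg
  obtain ⟨δ, hδ, hle⟩ := exists_pos_mul_pow_le_norm_sum hp b hb
  obtain ⟨M, hM⟩ := pow_unbounded_of_one_lt δ⁻¹ one_lt_two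
  ext j
  rw [← hy j, Pi.zero_apply, residue_eq_zero_iff, mem_maximalIdeal_moderate_iff]
  intro N
  filter_upwards [hg (M + N * p)] with n hn
  have hge : 0 ≤ Λ n := zero_le_two.trans (hΛ n)
  have h1 : δ * ‖Y n j‖ ^ p ≤ ‖eval (Y n) g‖ := by
    have h2 := hle (Y n)
    simp only [g, map_sum, map_mul, map_pow, eval_X, eval_C]
    refine le_trans ?_ h2
    gcongr
    exact norm_le_pi_norm (Y n) j
  have h2 : δ⁻¹ ≤ Λ n ^ M := hM.le.trans (pow_le_pow_left₀ zero_le_two (hΛ n) M)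
  have h3 : (‖Y n j‖ * Λ n ^ N) ^ p < 1 := by
    calc (‖Y n j‖ * Λ n ^ N) ^ p = (δ * ‖Y n j‖ ^ p) * (δ⁻¹ * Λ n ^ (N * p)) := by
          field_simp
          rw [mul_pow, ← pow_mul]
      _ ≤ ‖eval (Y n) g‖ * (Λ n ^ M * Λ n ^ (N * p)) := by gcongr
      _ < 1 := by rwa [← pow_add]
  by_contra! h4
  exact absurd (one_le_pow₀ h4) (not_le.2 h3)

/-- Moderate sequences nearly solving polynomial equations are approximated by exact solutions. -/
theorem exists_exact_solution [LocallyCompactSpace k] {σ : Type*} [Finite σ] {x : α → σ → k}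
    (hx : ∀ i, ((fun n => x n i : α → k) : Germ (U : Filter α) k) ∈ moderate k U hΛ) :
    ∃ Y : α → σ → k,
      (∀ g : MvPolynomial σ k, Tendsto (fun n => eval (Y n) g - eval (x n) g) U (𝓝 0)) ∧
      ∀ g : MvPolynomial σ k, (∀ N : ℕ, ∀ᶠ n in U, ‖eval (x n) g‖ * Λ n ^ N < 1) →
        ∀ᶠ n in U, eval (Y n) g = 0 := by
  have : ProperSpace k := ProperSpace.of_locallyCompactSpace k
  have : HenselianLocalRing (moderate k U hΛ) := henselianLocalRing_moderate
  obtain ⟨y, hyx, hy⟩ := exists_lift_of_linearIndepOn_pow (k := k)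
    (fun p hp _ ι _ a ha => linearIndependent_pow_of_forall_sum_mul_pow hp
      (fun q b hb w hw => eq_zero_of_sum_mul_pow_eq_zero hp.ne_zero b hb w hw) ha)
    (fun i => (⟨_, hx i⟩ : moderate k U hΛ))
  obtain ⟨Y, hY, rfl⟩ := exists_eq_coe_of_moderate y
  refine ⟨Y, fun g => ?_, fun g hg => ?_⟩
  · have h : aeval (fun i => (⟨_, hY i⟩ : moderate k U hΛ)) g -
        aeval (fun i => (⟨_, hx i⟩ : moderate k U hΛ)) g ∈ maximalIdeal (moderate k U hΛ) := by
      have hcomp : (IsScalarTower.toAlgHom k (moderate k U hΛ)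
          (ResidueField (moderate k U hΛ))).comp
          (aeval (fun i => (⟨_, hY i⟩ : moderate k U hΛ))) =
          (IsScalarTower.toAlgHom k (moderate k U hΛ)
          (ResidueField (moderate k U hΛ))).comp
          (aeval (fun i => (⟨_, hx i⟩ : moderate k U hΛ))) := by
        ext i
        have : residue (moderate k U hΛ) (⟨_, hY i⟩ - ⟨_, hx i⟩) = 0 :=
          (residue_eq_zero_iff (R := moderate k U hΛ) _).2 (hyx i)
        rw [map_sub, sub_eq_zero] at this
        simpa using this
      rw [← residue_eq_zero_iff, map_sub, sub_eq_zero]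
      exact DFunLike.congr_fun hcomp g
    have heq : (aeval (fun i => (⟨_, hY i⟩ : moderate k U hΛ)) g -
        aeval (fun i => (⟨_, hx i⟩ : moderate k U hΛ)) g : Germ (U : Filter α) k) =
        ((fun n => eval (Y n) g - eval (x n) g : α → k) : Germ (U : Filter α) k) := by
      rw [aeval_moderate hY, aeval_moderate hx]
      rfl
    have hmem : ((fun n => eval (Y n) g - eval (x n) g : α → k) : Germ (U : Filter α) k) ∈
        moderate k U hΛ := by
      rw [← heq]
      exact sub_mem (SetLike.coe_mem _) (SetLike.coe_mem _)
    refine tendsto_zero_of_mem_maximalIdeal (hf := hmem) ?_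
    convert h using 1
    exact Subtype.ext heq.symm
  · have hmem : ((fun n => eval (x n) g : α → k) : Germ (U : Filter α) k) ∈ moderate k U hΛ :=
      aeval_moderate hx g ▸ (aeval (fun i => (⟨_, hx i⟩ : moderate k U hΛ)) g).2
    have h0 := hy g (by
      rw [show aeval (fun i => (⟨_, hx i⟩ : moderate k U hΛ)) g = ⟨_, hmem⟩ from
        Subtype.ext (aeval_moderate hx g), mem_maximalIdeal_moderate_iff]
      exact hg)
    have h1 := aeval_moderate hY g
    rw [h0] at h1
    exact coe_eq.1 h1.symm

end Filter.Germ

theorem eval_det_pderiv {k : Type*} [CommRing k] {m r : ℕ} (f : Fin r → MvPolynomial (Fin m) k)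
    (ι : Fin r → Fin m) (x : Fin m → k) :
    eval x (Matrix.of fun a b => pderiv (ι b) (f a) :
      Matrix (Fin r) (Fin r) (MvPolynomial (Fin m) k)).det =
    (Matrix.of fun a b => eval x (pderiv (ι b) (f a)) : Matrix (Fin r) (Fin r) k).det := by
  rw [RingHom.map_det]
  rfl

/-- Along a sequence whose Jacobian minors decay faster than any power of the norm, the values
of a polynomial map accumulate at critical values. -/
theorem mem_closure_criticalValues_of_minors_lt {k : Type*} [NontriviallyNormedField k]
    [LocallyCompactSpace k] {m r : ℕ} (f : Fin r → MvPolynomial (Fin m) k)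
    {x : ℕ → Fin m → k} (hx : ∀ n, 1 ≤ ‖x n‖)
    (hdet : ∀ n, ∀ ι : Fin r ↪ Fin m,
      ‖(Matrix.of fun a b => eval (x n) (pderiv (ι b) (f a)) : Matrix (Fin r) (Fin r) k).det‖ <
        2⁻¹ ^ n / ‖x n‖ ^ n)
    {c : Fin r → k}
    (hc : Tendsto (fun n i => eval (x n) (f i)) (hyperfilter ℕ : Ultrafilter ℕ) (𝓝 c)) :
    c ∈ closure {y : Fin r → k | ∃ x : Fin m → k,
      (Matrix.of fun i j => eval x (pderiv j (f i)) : Matrix (Fin r) (Fin m) k).rank < r ∧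
      (fun i => eval x (f i)) = y} := by
  have hΛ (n : ℕ) : 2 ≤ 2 * ‖x n‖ := by linarith [hx n]
  have hmem (i : Fin m) : ((fun n => x n i : ℕ → k) : Germ (hyperfilter ℕ : Filter ℕ) k) ∈
      Germ.moderate k (hyperfilter ℕ) hΛ :=
    Germ.coe_mem_moderate.2 ⟨1, .of_forall fun n => by
      linarith [norm_le_pi_norm (x n) i, norm_nonneg (x n)]⟩
  obtain ⟨Y, hY, hY0⟩ := Germ.exists_exact_solution hmem
  have hvanish : ∀ᶠ n in hyperfilter ℕ, ∀ ι : Fin r ↪ Fin m,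
      (Matrix.of fun a b => eval (Y n) (pderiv (ι b) (f a)) : Matrix (Fin r) (Fin r) k).det = 0 := by
    refine eventually_all.2 fun ι => ?_
    simp_rw [← eval_det_pderiv]
    refine hY0 _ fun N => Nat.hyperfilter_le_atTop ?_
    filter_upwards [eventually_ge_atTop N] with n hn
    rw [eval_det_pderiv]
    have h0 : 0 < 2 * ‖x n‖ := by linarith [hΛ n]
    calc _ < (2⁻¹ ^ n / ‖x n‖ ^ n) * (2 * ‖x n‖) ^ N := by gcongr; exact hdet n ι
      _ ≤ (2⁻¹ ^ n / ‖x n‖ ^ n) * (2 * ‖x n‖) ^ n := by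
        gcongr
        linarith [hΛ n]
      _ = 1 := by
        have : ‖x n‖ ≠ 0 := by linarith [hx n]
        rw [mul_pow, inv_pow]
        field_simp
  refine mem_closure_of_tendsto (b := (hyperfilter ℕ : Filter ℕ))
    (f := fun n i => eval (Y n) (f i)) ?_ ?_
  · have h : Tendsto (fun n i => eval (Y n) (f i) - eval (x n) (f i))
        (hyperfilter ℕ : Filter ℕ) (𝓝 0) := tendsto_pi_nhds.2 fun i => hY (f i)
    simpa using (h.add hc).congr fun n => by ext i; simp
  · filter_upwards [hvanish] with n hn
    refine ⟨Y n, lt_of_le_of_ne (Matrix.rank_le_height _) fun h => ?_, rfl⟩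
    obtain ⟨ι, hι⟩ := Matrix.exists_submatrix_det_ne_zero_of_rank_eq _ h
    exact hι (hn ι)

end



/-- Let `k` be a local field and `f = (f₁,…,f_r) : k^m → k^r`
a polynomial map with `df₁ ∧ … ∧ df_r` not identically zero.  Let `ω ⊆ k^r` be
open with compact closure, the closure of `ω` being disjoint from the closure
of the set of critical values of `f`.  Then there are `C > 0`, `γ ≥ 0` with
`‖∇_r f(x)‖ = max_J |∂_J(x)| ≥ C/‖x‖^γ` for all `c ∈ ω`, `x ∈ L_c`, `‖x‖ ≥ 1`
(the lower bound on the maximum is expressed by exhibiting one Jacobian minor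
`∂_J`, `J` the range of an embedding `ι : Fin r ↪ Fin m`, with
`|∂_J(x)| ≥ C/‖x‖^γ`). -/
theorem stmt12 {k : Type*} [NontriviallyNormedField k] [LocallyCompactSpace k]
    {m r : ℕ} (f : Fin r → MvPolynomial (Fin m) k)
    (hrank : ∃ x : Fin m → k,
      (Matrix.of fun i j => eval x (pderiv j (f i)) : Matrix (Fin r) (Fin m) k).rank = r)
    (ω : Set (Fin r → k)) (hω : IsOpen ω) (hωc : IsCompact (closure ω))
    (hdisj : Disjoint (closure ω)
      (closure {y : Fin r → k | ∃ x : Fin m → k,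
        (Matrix.of fun i j => eval x (pderiv j (f i)) : Matrix (Fin r) (Fin m) k).rank < r ∧
        (fun i => eval x (f i)) = y})) :
    ∃ C > (0 : ℝ), ∃ γ : ℝ, 0 ≤ γ ∧
      ∀ c ∈ ω, ∀ x : Fin m → k, (∀ i, eval x (f i) = c i) → 1 ≤ ‖x‖ →
        ∃ ι : Fin r ↪ Fin m,
          C / ‖x‖ ^ γ ≤
            ‖(Matrix.of fun a b => eval x (pderiv (ι b) (f a)) :
                Matrix (Fin r) (Fin r) k).det‖ := by
  by_contra! H
  choose c hcω x hxc hx hdet using fun n : ℕ => H (2⁻¹ ^ n) (by positivity) n n.cast_nonneg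
  simp_rw [Real.rpow_natCast] at hdet
  obtain ⟨c₀, hc₀, hlim⟩ := hωc.ultrafilter_le_nhds' ((Filter.hyperfilter ℕ).map c)
    (Filter.mem_map.2 (Filter.Eventually.of_forall fun n => subset_closure (hcω n)))
  have hcx : (fun n i => eval (x n) (f i)) = c := funext fun n => funext (hxc n)
  refine hdisj.le_bot ⟨hc₀, mem_closure_criticalValues_of_minors_lt f hx hdet ?_⟩
  rw [hcx]
  exact hlim
end

section
/- Let k be a local field of arbitrary characteristic and K an algebraic closure of k. Then there exists a countable family {k_n} of intermediate fields k ⊆ k_n ⊆ K, each finite-dimensional over k, such that every intermediate field k ⊆ k' ⊆ K that is finite-dimensional over k is contained in some k_n. In particular, K = ⋃_n k_n. -/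
open Polynomial IntermediateField in
/-- By Krasner's lemma, every separable element lies in the field generated by the elements that
are algebraic over a given dense subfield. -/
theorem IsSeparable.mem_adjoin_isAlgebraic_of_denseRange {D k K : Type*} [Field D]
    [NontriviallyNormedField k] [CompleteSpace k] [IsUltrametricDist k] [Algebra D k]
    (hD : DenseRange (algebraMap D k)) [Field K] [Algebra k K] [Algebra D K]
    [IsScalarTower D k K] [Algebra.IsAlgebraic k K] [IsAlgClosed K] {x : K}
    (hx : IsSeparable k x) : x ∈ adjoin k {y : K | IsAlgebraic D y} := by
  let : NormedField K := spectralNorm.normedField k K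
  let : NormedAlgebra k K := spectralNorm.normedAlgebra k K
  obtain ⟨δ, hδ, hconj⟩ : ∃ δ > 0, ∀ x' : K, IsConjRoot k x x' → x ≠ x' → δ ≤ ‖x - x'‖ := by
    have hfin : {x' : K | IsConjRoot k x x' ∧ x ≠ x'}.Finite :=
      ((minpoly k x).rootSet_finite K).subset fun y hy =>
        (isConjRoot_iff_mem_minpoly_rootSet hx.isIntegral).1 hy.1
    rcases Set.eq_empty_or_nonempty {x' : K | IsConjRoot k x x' ∧ x ≠ x'} with h | h
    · exact ⟨1, one_pos, fun y h₁ h₂ => absurd (h ▸ ⟨h₁, h₂⟩ : y ∈ (∅ : Set K)) (by simp)⟩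
    · obtain ⟨z, hz, hmin⟩ := Set.exists_min_image _ (fun y => ‖x - y‖) hfin h
      exact ⟨‖x - z‖, norm_pos_iff.2 (sub_ne_zero.2 hz.2), fun y h₁ h₂ => hmin y ⟨h₁, h₂⟩⟩
  set f := minpoly k x
  have fmon : f.Monic := minpoly.monic hx.isIntegral
  have fdeg : f.natDegree ≠ 0 := (minpoly.natDegree_pos hx.isIntegral).ne'
  have hε : 0 < (δ / (max ‖x‖ 1)) ^ f.natDegree / (f.natDegree + 1) := by positivity
  obtain ⟨g, gmon, gdeg, gcoeff⟩ :=
    exists_monic_and_natDegree_eq_and_norm_map_algebraMap_coeff_sub_lt hD fmon hε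
  obtain ⟨b, hb, hxb⟩ := exists_aroots_norm_sub_lt_of_norm_coeff_sub_lt
    hε (minpoly.aeval k x) fmon (gmon.map _) (gdeg ▸ (g.natDegree_map _)) gcoeff
    (IsAlgClosed.splits _)
  have hxb : ‖x - b‖ < δ := by
    rw [← Real.rpow_natCast, ← mul_comm_div, div_self, one_mul,
      ← Real.rpow_mul (div_pos hδ (by positivity)).le, mul_inv_cancel₀] at hxb
    · simpa [mul_assoc, div_mul_cancel₀ _ (by positivity : (max ‖x‖ 1) > 0).ne'] using hxb
    · simp [fdeg]
    · positivity
  have hroot : aeval b (g.map (algebraMap D k)) = 0 := (mem_aroots.1 hb).2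
  have hbalg : IsAlgebraic D b := ⟨g, gmon.ne_zero, by simpa using hroot⟩
  have hmem : x ∈ k⟮b⟯ := IsKrasner.krasner hx (IsAlgClosed.splits _)
    ⟨_, gmon.map _, by simpa [aeval_def] using hroot⟩
    fun x' h₁ h₂ => hxb.trans_le (hconj x' h₁ h₂)
  have hsub : {b} ⊆ {y : K | IsAlgebraic D y} := Set.singleton_subset_iff.2 hbalg
  exact adjoin.mono k _ _ hsub hmem

/-- A continuous homomorphism from a complete nontrivially normed field to a locally compact
Hausdorff topological ring is finite. -/
theorem RingHom.finite_of_continuous_of_locallyCompactSpace {E A : Type*}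
    [NontriviallyNormedField E] [CompleteSpace E] [CommRing A] [TopologicalSpace A]
    [IsTopologicalRing A] [T2Space A] [LocallyCompactSpace A] (φ : E →+* A)
    (hφ : Continuous φ) : φ.Finite := by
  let := φ.toAlgebra
  have : ContinuousSMul E A := ⟨by
    simp only [Algebra.smul_def]
    exact (hφ.comp continuous_fst).mul continuous_snd⟩
  exact FiniteDimensional.of_locallyCompactSpace E

/-- The target of a finite ring homomorphism is spanned by a finite set over the range. -/
theorem RingHom.Finite.exists_finset_span_range_eq_top {A B : Type*} [CommRing A] [CommRing B]
    {φ : A →+* B} (hφ : φ.Finite) :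
    ∃ s : Finset B, Submodule.span φ.range (s : Set B) = ⊤ := by
  let := φ.toAlgebra
  obtain ⟨s, hs⟩ := (show Module.Finite A B from hφ).fg_top
  refine ⟨s, eq_top_iff.2 fun c _ => ?_⟩
  have hc : c ∈ Submodule.span A (s : Set B) := hs ▸ Submodule.mem_top
  induction hc using Submodule.span_induction with
  | mem c hc => exact Submodule.subset_span hc
  | zero => exact zero_mem _
  | add a b _ _ ha hb => exact add_mem (ha trivial) (hb trivial)
  | smul a b _ hb =>
    exact Submodule.smul_mem _ (⟨φ a, a, rfl⟩ : φ.range) (hb trivial)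

/-- The subfield generated by a countable set is countable. -/
theorem Subfield.countable_closure {k : Type*} [Field k] {s : Set k} (hs : s.Countable) :
    (Subfield.closure s : Set k).Countable := by
  have := hs.to_subtype
  have : Countable (MvPolynomial s ℤ) := by
    rw [← Cardinal.mk_le_aleph0_iff]
    refine MvPolynomial.cardinalMk_le_max_lift.trans ?_
    simp
  let f : MvPolynomial s ℤ →ₐ[ℤ] k := MvPolynomial.aeval Subtype.val
  have hle : Subring.closure s ≤ f.toRingHom.range :=
    Subring.closure_le.2 fun x hx => ⟨MvPolynomial.X ⟨x, hx⟩, MvPolynomial.aeval_X _ _⟩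
  refine (Set.countable_range fun p : MvPolynomial s ℤ × MvPolynomial s ℤ => f p.1 / f p.2).mono ?_
  intro x hx
  obtain ⟨y, hy, z, hz, rfl⟩ := Subfield.mem_closure_iff.1 hx
  obtain ⟨a, rfl⟩ := hle hy
  obtain ⟨b, rfl⟩ := hle hz
  exact ⟨(a, b), rfl⟩

/-- If the norm of a complete normed field is unbounded on the natural numbers, then the field
receives a continuous homomorphism from the real numbers. -/
theorem exists_continuous_ringHom_real {k : Type*} [NormedField k] [CompleteSpace k]
    (h : ¬ ∀ n : ℕ, ‖(n : k)‖ ≤ 1) : ∃ φ : ℝ →+* k, Continuous φ := by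
  have : CharZero k := by
    obtain ⟨p, hp⟩ := CharP.exists k
    rcases Nat.eq_zero_or_pos p with rfl | hpos
    · exact CharP.charP_to_charZero k
    · refine absurd (fun n => ?_) h
      have : NeZero p := ⟨hpos.ne'⟩
      by_contra! hn
      obtain ⟨N, hN⟩ : ∃ N : ℝ, ∀ m : ℕ, ‖(m : k)‖ ≤ N := by
        obtain ⟨N, hN⟩ := ((Set.finite_Iio p).image fun m : ℕ => ‖(m : k)‖).bddAbove
        refine ⟨N, fun m => ?_⟩
        rw [CharP.cast_eq_mod k p m]
        exact hN ⟨m % p, Nat.mod_lt _ hpos, rfl⟩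
      obtain ⟨j, hj⟩ := pow_unbounded_of_one_lt N hn
      have := hN (n ^ j)
      rw [Nat.cast_pow, norm_pow] at this
      exact this.not_gt hj
  let v : AbsoluteValue ℚ ℝ :=
    { toFun := fun x => ‖(x : k)‖
      map_mul' := by simp
      nonneg' := by simp
      eq_zero' := by simp
      add_le' := fun x y => by simpa using norm_add_le (x : k) y }
  have hv : v.IsEquiv Rat.AbsoluteValue.real :=
    Rat.AbsoluteValue.equiv_real_of_unbounded (by simpa [v] using h)
  have h2 : v (1 / 2) < 1 := hv.lt_one_iff.2 (by rw [Rat.AbsoluteValue.real_eq_abs]; norm_num)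
  have hu : UniformContinuous (Rat.castHom k) := by
    refine uniformContinuous_of_continuousAt_zero (Rat.castHom k) ?_
    rw [Metric.continuousAt_iff]
    intro ε hε
    obtain ⟨m, hm⟩ := exists_pow_lt_of_lt_one hε h2
    refine ⟨(1 / 2) ^ m, by positivity, fun {x} hx => ?_⟩
    rw [map_zero, dist_zero_right]
    refine lt_trans (?_ : v x < v ((1 / 2) ^ m)) (by rwa [map_pow])
    rw [hv.lt_iff_lt, Rat.AbsoluteValue.real_eq_abs, Rat.AbsoluteValue.real_eq_abs]
    rw [Rat.dist_eq, Rat.cast_zero, sub_zero] at hx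
    rw [abs_of_pos (by positivity : (0 : ℚ) < (1 / 2) ^ m)]
    push_cast at hx ⊢
    exact hx
  have ui : IsUniformInducing (Rat.castHom ℝ) := Rat.isUniformEmbedding_coe_real.isUniformInducing
  have hd : DenseRange (Rat.castHom ℝ) := Rat.denseRange_cast
  exact ⟨IsDenseInducing.extendRingHom ui hd hu,
    (uniformContinuous_uniformly_extend ui hd hu).continuous⟩

/-- The algebraic closure of a field that is finite over the real numbers is finite. -/
theorem IsAlgClosure.finiteDimensional_of_finite_ringHom_real {k K : Type*} [Field k] [Field K]
    [Algebra k K] [IsAlgClosure k K] (φ : ℝ →+* k) (hφ : φ.Finite) : FiniteDimensional k K := by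
  let := φ.toAlgebra
  let := ((algebraMap k K).comp φ).toAlgebra
  have : IsScalarTower ℝ k K := .of_algebraMap_eq fun _ => rfl
  have : Module.Finite ℝ k := hφ
  have : Algebra.IsAlgebraic k K := IsAlgClosure.isAlgebraic
  have : Algebra.IsAlgebraic ℝ K := Algebra.IsAlgebraic.trans ℝ k K
  have : IsAlgClosed K := IsAlgClosure.isAlgClosed k
  have : IsAlgClosure ℝ K := ⟨inferInstance, inferInstance⟩
  have : IsAlgClosure ℝ ℂ := ⟨inferInstance, inferInstance⟩
  have : FiniteDimensional ℝ K := (IsAlgClosure.equiv ℝ ℂ K).toLinearEquiv.finiteDimensional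
  exact FiniteDimensional.right ℝ k K

open IntermediateField in
/-- Let `K` be an algebraically closed algebraic extension of `k` and `D` a subfield of `k` which
contains a spanning set of `k` over the image of the Frobenius endomorphism. If all separable
elements of `K` lie in the field generated over `k` by the elements algebraic over `D`, then this
field is all of `K`. -/
theorem IntermediateField.adjoin_isAlgebraic_eq_top_of_frobenius {D k K : Type*} [Field D] [Field k]
    [Field K] [Algebra D k] [Algebra k K] [Algebra D K] [IsScalarTower D k K]
    [Algebra.IsAlgebraic k K] [IsAlgClosed K] (q : ℕ) [ExpChar k q] (s : Set k)
    (hs : ∀ c : k, c ∈ Submodule.span ((frobenius k q).range) s)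
    (hsD : s ⊆ Set.range (algebraMap D k))
    (hsep : ∀ x : K, IsSeparable k x → x ∈ adjoin k {y : K | IsAlgebraic D y}) :
    adjoin k {y : K | IsAlgebraic D y} = ⊤ := by
  set M := adjoin k {y : K | IsAlgebraic D y}
  have : ExpChar K q := expChar_of_injective_algebraMap (algebraMap k K).injective q
  have hq : 0 < q := expChar_pos k q
  have halg : ∀ y : K, IsAlgebraic D y → ∃ z ∈ M, z ^ q = y := by
    intro y hy
    obtain ⟨z, rfl⟩ := IsAlgClosed.exists_pow_nat_eq y hq
    exact ⟨z, subset_adjoin k _ (hy.of_pow hq), rfl⟩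
  have hroot : ∀ y ∈ M, ∃ z ∈ M, z ^ q = y := by
    intro y hy
    induction hy using adjoin_induction with
    | mem y hy => exact halg y hy
    | algebraMap c =>
      induction hs c using Submodule.span_induction with
      | mem c hc =>
        obtain ⟨d, rfl⟩ := hsD hc
        rw [← IsScalarTower.algebraMap_apply]
        exact halg _ (isAlgebraic_algebraMap d)
      | zero => exact ⟨0, zero_mem _, by simp [hq.ne']⟩
      | add a b _ _ ha hb =>
        obtain ⟨u, hu, hu'⟩ := ha
        obtain ⟨w, hw, hw'⟩ := hb
        exact ⟨u + w, add_mem hu hw, by rw [add_pow_expChar, hu', hw', map_add]⟩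
      | smul a b _ hb =>
        obtain ⟨_, a, rfl⟩ := a
        obtain ⟨w, hw, hw'⟩ := hb
        refine ⟨algebraMap k K a * w, mul_mem (M.algebraMap_mem a) hw, ?_⟩
        change _ = algebraMap k K (a ^ q * b)
        rw [mul_pow, hw', map_mul, map_pow]
    | add a b _ _ ha hb =>
      obtain ⟨u, hu, rfl⟩ := ha
      obtain ⟨w, hw, rfl⟩ := hb
      exact ⟨u + w, add_mem hu hw, add_pow_expChar u w q⟩
    | inv a _ ha =>
      obtain ⟨u, hu, rfl⟩ := ha
      exact ⟨u⁻¹, inv_mem hu, inv_pow u q⟩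
    | mul a b _ _ ha hb =>
      obtain ⟨u, hu, rfl⟩ := ha
      obtain ⟨w, hw, rfl⟩ := hb
      exact ⟨u * w, mul_mem hu hw, mul_pow u w q⟩
  have hdesc : ∀ (n : ℕ) (x : K), x ^ q ^ n ∈ M → x ∈ M := by
    intro n
    induction n with
    | zero => intro x hx; simpa using hx
    | succ n ih =>
      intro x hx
      obtain ⟨z, hz, hzx⟩ := hroot _ hx
      refine ih x ?_
      rw [pow_succ, pow_mul] at hzx
      exact frobenius_inj K q hzx ▸ hz
  refine eq_top_iff.2 fun x _ => ?_
  obtain ⟨n, y, hy⟩ := IsPurelyInseparable.pow_mem (separableClosure k K) q x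
  exact hdesc n x (hy ▸ hsep _ (mem_separableClosure_iff.1 y.2))

open IntermediateField in
/-- A countably generated algebraic extension is exhausted by a sequence of finite subextensions
which is cofinal among all finite subextensions. -/
theorem IntermediateField.exists_cofinal_seq_of_countable_adjoin_eq_top {k K : Type*} [Field k]
    [Field K] [Algebra k K] [Algebra.IsAlgebraic k K] {S : Set K} (hS : S.Countable)
    (htop : adjoin k S = ⊤) :
    ∃ F : ℕ → IntermediateField k K,
      (∀ n, FiniteDimensional k (F n)) ∧
      (∀ L : IntermediateField k K, FiniteDimensional k L → ∃ n, L ≤ F n) ∧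
      (∀ x : K, ∃ n, x ∈ F n) := by
  obtain ⟨f, hf⟩ := (hS.insert 0).exists_eq_range (Set.insert_nonempty _ _)
  let F : ℕ → IntermediateField k K := fun n => adjoin k (f '' Set.Iic n)
  have hmono : Monotone F := fun m n h =>
    adjoin.mono k _ _ (Set.image_mono (Set.Iic_subset_Iic.2 h))
  have hmem : ∀ x : K, ∃ n, x ∈ F n := by
    intro x
    have hle : adjoin k S ≤ ⨆ n, F n := by
      refine adjoin_le_iff.2 fun s hs => ?_
      obtain ⟨n, rfl⟩ : s ∈ Set.range f := hf ▸ Set.mem_insert_of_mem _ hs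
      exact (le_iSup F n) (subset_adjoin k _ ⟨n, Set.self_mem_Iic, rfl⟩)
    have hx : x ∈ ⨆ n, F n := hle (htop ▸ mem_top)
    rw [← SetLike.mem_coe, coe_iSup_of_directed hmono.directed_le] at hx
    exact Set.mem_iUnion.1 hx
  refine ⟨F, fun n => ?_, fun L _ => ?_, hmem⟩
  · have : Finite (f '' Set.Iic n) := ((Set.finite_Iic n).image f).to_subtype
    exact finiteDimensional_adjoin fun x _ => Algebra.IsIntegral.isIntegral x
  · obtain ⟨t, rfl⟩ := essFiniteType_iff.1 (inferInstance : Algebra.EssFiniteType k L)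
    choose N hN using hmem
    refine ⟨t.sup N, adjoin_le_iff.2 fun x hx => hmono (Finset.le_sup hx) (hN x)⟩

/-- Let `k` be a local field and `K` an algebraic closure of
`k`.  Then there is a countable family `{k_n}` of finite extensions of `k`
inside `K` such that every finite extension of `k` inside `K` is contained in
some `k_n`; in particular `K = ⋃_n k_n`. -/
theorem stmt13 {k : Type*} [NontriviallyNormedField k] [LocallyCompactSpace k]
    {K : Type*} [Field K] [Algebra k K] [IsAlgClosure k K] :
    ∃ F : ℕ → IntermediateField k K,
      (∀ n, FiniteDimensional k (F n)) ∧
      (∀ L : IntermediateField k K, FiniteDimensional k L → ∃ n, L ≤ F n) ∧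
      (∀ x : K, ∃ n, x ∈ F n) := by
  have : ProperSpace k := .of_locallyCompactSpace k
  have : Algebra.IsAlgebraic k K := IsAlgClosure.isAlgebraic
  have : IsAlgClosed K := IsAlgClosure.isAlgClosed k
  by_cases hna : ∀ n : ℕ, ‖(n : k)‖ ≤ 1
  swap
  · obtain ⟨φ, hφ⟩ := exists_continuous_ringHom_real hna
    have := IsAlgClosure.finiteDimensional_of_finite_ringHom_real (K := K) φ
      (φ.finite_of_continuous_of_locallyCompactSpace hφ)
    exact ⟨fun _ => ⊤, fun _ => inferInstance, fun _ _ => ⟨0, le_top⟩,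
      fun _ => ⟨0, IntermediateField.mem_top⟩⟩
  have : IsUltrametricDist k :=
    IsUltrametricDist.isUltrametricDist_of_forall_norm_natCast_le_one hna
  obtain ⟨q, _⟩ := ExpChar.exists k
  have hfrob : (frobenius k q).Finite :=
    RingHom.finite_of_continuous_of_locallyCompactSpace _ (continuous_pow q)
  obtain ⟨s, hs⟩ := hfrob.exists_finset_span_range_eq_top
  let T : Set k := Set.range (TopologicalSpace.denseSeq k) ∪ s
  let D : Subfield k := Subfield.closure T
  have hT : T ⊆ D := Subfield.subset_closure
  have : Countable D :=
    (Subfield.countable_closure ((Set.countable_range _).union s.countable_toSet)).to_subtype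
  have hD : DenseRange (algebraMap D k) := by
    refine (TopologicalSpace.denseRange_denseSeq k).mono ?_
    exact fun x hx => ⟨⟨x, hT (Or.inl hx)⟩, rfl⟩
  refine IntermediateField.exists_cofinal_seq_of_countable_adjoin_eq_top
    (Algebraic.countable D K)
    (IntermediateField.adjoin_isAlgebraic_eq_top_of_frobenius q s
      (fun c => hs ▸ Submodule.mem_top) ?_
      fun x hx => hx.mem_adjoin_isAlgebraic_of_denseRange hD)
  intro x hx
  exact ⟨⟨x, hT (Or.inr hx)⟩, rfl⟩
end

section
/- Let K be an algebraically closed field and let U ⊆ K^r be a nonempty Zariski-open set (the complement of the common zero set of a family of polynomials). Let h₁,…,h_r ∈ K[x₁,…,x_r] be polynomials with deg h_i = d_i, and let Z_i ⊆ K^r be the zero locus of h_i and Z_i^× := Z_i ∩ U. If F := ⋂_{i=1}^r Z_i^× is nonempty and finite, then F has at most D := d₁·d₂⋯d_r elements. -/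
open MvPolynomial

section Counting

/-- The exponents in `r` variables of total degree at most `m`. -/
abbrev exponentsLE (r m : ℕ) : Set (Fin r →₀ ℕ) := {s | (s.sum fun _ e => e) ≤ m}

/-- The exponents in `r` variables of weighted degree at most `m`, for the weights `d`. -/
abbrev weightedExponentsLE {r : ℕ} (d : Fin r → ℕ) (m : ℕ) : Set (Fin r →₀ ℕ) :=
  {j | ∑ i, j i * d i ≤ m}

lemma apply_lt_of_mem_exponentsLE {r m : ℕ} (s : exponentsLE r m) (i : Fin r) :
    s.1 i < m + 1 := by
  have hs : (s.1.sum fun _ e => e) ≤ m := s.2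
  rw [Finsupp.sum_fintype _ _ (fun _ => rfl)] at hs
  exact Nat.lt_succ_of_le
    ((Finset.single_le_sum (fun _ _ => Nat.zero_le _) (Finset.mem_univ i)).trans hs)

lemma exponentsLE_coords_injective (r m : ℕ) :
    Function.Injective fun (s : exponentsLE r m) (i : Fin r) =>
      (⟨s.1 i, apply_lt_of_mem_exponentsLE s i⟩ : Fin (m + 1)) := by
  intro s t hst
  ext i
  simpa using congrFun hst i

instance finite_exponentsLE (r m : ℕ) : Finite (exponentsLE r m) :=
  Finite.of_injective _ (exponentsLE_coords_injective r m)

lemma card_exponentsLE_le (r m : ℕ) : Nat.card (exponentsLE r m) ≤ (m + 1) ^ r := by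
  simpa using Nat.card_le_card_of_injective _ (exponentsLE_coords_injective r m)

lemma finite_weightedExponentsLE {r : ℕ} {d : Fin r → ℕ} (hd : ∀ i, 0 < d i) (m : ℕ) :
    Finite (weightedExponentsLE d m) := by
  refine Set.Finite.subset (Set.toFinite (exponentsLE r m)) fun j hj => ?_
  simp only [Set.mem_ofPred_eq] at hj ⊢
  rw [Finsupp.sum_fintype _ _ (fun _ => rfl)]
  exact (Finset.sum_le_sum fun i _ => Nat.le_mul_of_pos_right _ (hd i)).trans hj

lemma card_exponentsLE_le_mul {r : ℕ} {d : Fin r → ℕ} (hd : ∀ i, 0 < d i) (m : ℕ) :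
    Nat.card (exponentsLE r m) ≤ (∏ i, d i) * Nat.card (weightedExponentsLE d m) := by
  have := finite_weightedExponentsLE hd m
  let f : exponentsLE r m → ((i : Fin r) → Fin (d i)) × weightedExponentsLE d m := fun s =>
    (fun i => ⟨s.1 i % d i, Nat.mod_lt _ (hd i)⟩,
      ⟨Finsupp.equivFunOnFinite.symm fun i => s.1 i / d i, by
        have hs : (s.1.sum fun _ e => e) ≤ m := s.2
        rw [Finsupp.sum_fintype _ _ (fun _ => rfl)] at hs
        simpa using (Finset.sum_le_sum fun i _ => Nat.div_mul_le_self (s.1 i) (d i)).trans hs⟩)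
  have hf : Function.Injective f := by
    intro s t hst
    ext i
    have h₁ : s.1 i % d i = t.1 i % d i := congrArg Fin.val (congrFun (congrArg Prod.fst hst) i)
    have h₂ : s.1 i / d i = t.1 i / d i := by
      simpa [f] using DFunLike.congr_fun (congrArg (fun x => x.2.1) hst) i
    rw [← Nat.div_add_mod (s.1 i) (d i), ← Nat.div_add_mod (t.1 i) (d i), h₁, h₂]
  simpa [Nat.card_prod, Nat.card_pi] using Nat.card_le_card_of_injective f hf

/-- A polynomially bounded function `T` that satisfies `N * T m ≤ D * T (m + a)` for all `m`
and does not vanish at `0` forces `N ≤ D`. -/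
lemma le_of_mul_le_mul_shift {N D a r : ℕ} {T : ℕ → ℕ} (h0 : 0 < T 0)
    (hT : ∀ m, T m ≤ (m + 1) ^ r) (h : ∀ m, N * T m ≤ D * T (m + a)) : N ≤ D := by
  by_contra! hlt
  have key : ∀ k, N ^ k * T 0 ≤ D ^ k * T (k * a) := by
    intro k
    induction k with
    | zero => simp
    | succ k ih =>
      calc N ^ (k + 1) * T 0 = N * (N ^ k * T 0) := by ring
        _ ≤ N * (D ^ k * T (k * a)) := Nat.mul_le_mul_left _ ih
        _ = D ^ k * (N * T (k * a)) := by ring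
        _ ≤ D ^ k * (D * T (k * a + a)) := Nat.mul_le_mul_left _ (h _)
        _ = D ^ (k + 1) * T ((k + 1) * a) := by rw [add_mul, one_mul]; ring
  have hN : (0 : ℝ) < N := by exact_mod_cast (Nat.zero_le D).trans_lt hlt
  have hlim := (tendsto_pow_const_mul_const_pow_of_lt_one r
    (r := (D : ℝ) / N) (by positivity)
    ((div_lt_one hN).2 (by exact_mod_cast hlt))).const_mul (((a : ℝ) + 1) ^ r)
  rw [mul_zero] at hlim
  obtain ⟨k, hk, hk1⟩ := ((hlim.eventually_lt_const one_pos).and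
    (Filter.eventually_ge_atTop 1)).exists
  have h₁ : N ^ k ≤ D ^ k * ((a + 1) * k) ^ r := by
    calc N ^ k ≤ N ^ k * T 0 := Nat.le_mul_of_pos_right _ h0
      _ ≤ D ^ k * T (k * a) := key k
      _ ≤ D ^ k * (k * a + 1) ^ r := Nat.mul_le_mul_left _ (hT _)
      _ ≤ _ := by gcongr; nlinarith
  have h₂ : (N : ℝ) ^ k ≤ D ^ k * ((a + 1) * k) ^ r := by exact_mod_cast h₁
  rw [div_pow, ← mul_assoc, ← mul_pow, ← mul_div_assoc, div_lt_one (by positivity)] at hk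
  linarith [mul_comm ((D : ℝ) ^ k) ((((a : ℝ) + 1) * k) ^ r)]

end Counting

section Height

variable {K : Type*} [Field K] {r : ℕ}

/-- The vanishing ideal of a point of affine `r`-space has height at least `r`. -/
lemma le_height_ker_eval (p : Fin r → K) : (r : ℕ∞) ≤ (RingHom.ker (eval p)).height := by
  let f : ℕ → MvPolynomial (Fin r) K →ₐ[K] MvPolynomial (Fin r) K := fun k =>
    aeval fun i => if i.1 < k then C (p i) else X i
  have hcomp : ∀ k, (f (k + 1)) = (f (k + 1)).comp (f k) := by
    intro k
    refine algHom_ext fun i => ?_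
    by_cases hi : i.1 < k
    · simp [f, hi, hi.le]
    · simp [f, hi]
  have key : ∀ k ≤ r, (k : ℕ∞) ≤ (RingHom.ker (f k)).height := by
    intro k
    induction k with
    | zero => simp
    | succ k ih =>
      intro hk
      have := RingHom.ker_isPrime (f k)
      have := RingHom.ker_isPrime (f (k + 1))
      have hlt : RingHom.ker (f k) < RingHom.ker (f (k + 1)) := by
        refine lt_of_le_of_ne (fun g hg => ?_) fun heq => ?_
        · rw [RingHom.mem_ker] at hg ⊢
          rw [hcomp, AlgHom.comp_apply, hg, map_zero]
        · have hmem : (X ⟨k, hk⟩ - C (p ⟨k, hk⟩) : MvPolynomial (Fin r) K) ∈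
              RingHom.ker (f k) := by
            rw [heq, RingHom.mem_ker]
            simp [f]
          rw [RingHom.mem_ker] at hmem
          have := congrArg (eval fun _ => p ⟨k, hk⟩ + 1) hmem
          simp [f] at this
      push_cast
      exact (add_le_add_left (ih (by omega)) 1).trans
        (Ideal.height_add_one_le_of_lt_of_isPrime hlt)
  refine (key r le_rfl).trans (Ideal.height_mono fun g hg => ?_)
  have hr : f r = (Algebra.ofId K _).comp (aeval p) := by
    refine algHom_ext fun i => ?_
    simp [f, Algebra.ofId_apply]
  rw [RingHom.mem_ker, hr] at hg
  simpa [Algebra.ofId_apply, aeval_eq_eval] using hg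

end Height

section Independence

variable {K : Type*} [Field K] [Infinite K] {r : ℕ}

/-- A system of parameters at a point is analytically independent: a polynomial relation between
its members has all its lowest coefficients vanishing at the point. -/
lemma eval_ne_zero_of_isolated (p : Fin r → K) (h : Fin r → MvPolynomial (Fin r) K)
    (hmin : RingHom.ker (eval p) ∈ (Ideal.span (Set.range h)).minimalPrimes)
    (k : Fin r) (G : MvPolynomial (Fin r) (MvPolynomial (Fin r) K)) (n : ℕ)
    (hlow : ∀ j ∈ G.support, n ≤ j.degree) (j₀ : Fin r →₀ ℕ) (hj₀ : j₀.degree = n)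
    (hne : eval p (coeff j₀ G) ≠ 0) : eval h G ≠ 0 := by
  classical
  intro hG
  let φ : MvPolynomial (Fin r) K :=
    ∑ j ∈ G.support, monomial j (eval p (coeff j G) * 0 ^ (j.degree - n))
  have hφ : φ ≠ 0 := by
    refine ne_zero_iff.2 ⟨j₀, ?_⟩
    have hmem : j₀ ∈ G.support := by
      rw [mem_support_iff]
      intro h0
      simp [h0] at hne
    simp [φ, coeff_sum, coeff_monomial, hmem, hj₀, hne]
  obtain ⟨v, hv⟩ : ∃ v, eval v (φ * X k) ≠ 0 := by
    by_contra! hv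
    exact mul_ne_zero hφ (X_ne_zero k) (MvPolynomial.funext fun x => by simpa using hv x)
  rw [map_mul, eval_X] at hv
  have hvφ := left_ne_zero_of_mul hv
  have hvk := right_ne_zero_of_mul hv
  have hzero : ∀ i, eval p (h i) = 0 := fun i =>
    hmin.1.2 (Ideal.subset_span ⟨i, rfl⟩)
  let s : MvPolynomial (Fin r) K := C (v k)⁻¹ * h k
  let S : Finset (MvPolynomial (Fin r) K) :=
    (Finset.univ.erase k).image fun i => h i - C (v i) * s
  have hs : eval p s = 0 := by simp [s, hzero]
  have hSle : Ideal.span (S : Set (MvPolynomial (Fin r) K)) ≤ RingHom.ker (eval p) := by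
    rw [Ideal.span_le]
    intro g hg
    obtain ⟨i, -, rfl⟩ := Finset.mem_image.1 hg
    simp [RingHom.mem_ker, hs, hzero]
  have hS : RingHom.ker (eval p) ∈
      (Ideal.span (S : Set (MvPolynomial (Fin r) K))).minimalPrimes := by
    refine ⟨⟨RingHom.ker_isPrime _, hSle⟩, ?_⟩
    rintro q ⟨hq, hSq⟩ hqp
    have hdiff : ∀ i, Ideal.Quotient.mk q (h i) = Ideal.Quotient.mk q (C (v i) * s) := by
      intro i
      by_cases hi : i = k
      · subst hi
        rw [← mul_assoc, ← C_mul, mul_inv_cancel₀ hvk, C_1, one_mul]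
      · exact Ideal.Quotient.eq.2
          (hSq (Ideal.subset_span (Finset.mem_image_of_mem _ (by simp [hi]))))
    let w : MvPolynomial (Fin r) K :=
      ∑ j ∈ G.support, coeff j G * C (∏ i, v i ^ j i) * s ^ (j.degree - n)
    have hw : s ^ n * w ∈ q := by
      rw [← Ideal.Quotient.eq_zero_iff_mem, ← map_zero (Ideal.Quotient.mk q), ← hG, eval_eq',
        Finset.mul_sum, map_sum, map_sum]
      refine Finset.sum_congr rfl fun j hj => ?_
      have hpow : s ^ j.degree = s ^ n * s ^ (j.degree - n) := by
        rw [← pow_add, Nat.add_sub_cancel' (hlow j hj)]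
      have hprod : Ideal.Quotient.mk q (∏ i, h i ^ j i) =
          Ideal.Quotient.mk q (C (∏ i, v i ^ j i) * s ^ j.degree) := by
        simp only [map_prod, map_pow, hdiff]
        simp only [map_mul, mul_pow, Finset.prod_mul_distrib, map_prod, map_pow,
          Finset.prod_pow_eq_pow_sum, Finsupp.degree_eq_sum]
      rw [map_mul _ (coeff j G), hprod, ← map_mul, hpow]
      congr 1
      ring
    have hwp : w ∉ q := by
      intro hwq
      refine hvφ ?_
      have h0 : eval p w = 0 := hqp hwq
      rw [← h0]
      simp only [φ, w, map_sum, map_mul, map_pow, hs, eval_monomial, eval_C]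
      refine Finset.sum_congr rfl fun j _ => ?_
      rw [Finsupp.prod_fintype _ _ (fun _ => pow_zero _)]
      ring
    have hsq : s ∈ q := hq.mem_of_pow_mem _ ((hq.mem_or_mem hw).resolve_right hwp)
    refine hmin.2 ⟨hq, Ideal.span_le.2 ?_⟩ hqp
    rintro _ ⟨i, rfl⟩
    rw [SetLike.mem_coe, ← Ideal.Quotient.eq_zero_iff_mem, hdiff,
      Ideal.Quotient.eq_zero_iff_mem]
    exact q.mul_mem_left _ hsq
  have hle := (le_height_ker_eval p).trans
    (Ideal.height_le_card_of_mem_minimalPrimes_span_finset hS)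
  have hcard : S.card ≤ r - 1 := Finset.card_image_le.trans (by simp)
  have : r ≤ S.card := by exact_mod_cast hle
  have := k.pos
  omega

end Independence

section Isolated

variable {K : Type*} [Field K] {r : ℕ}

/-- Lagrange interpolation on a finite set of points. -/
lemma exists_eval_eq_ite (F : Finset (Fin r → K)) (p : Fin r → K) :
    ∃ e : MvPolynomial (Fin r) K, eval p e = 1 ∧ ∀ z ∈ F, z ≠ p → eval z e = 0 := by
  classical
  have hsep : ∀ z : Fin r → K, ∃ e : MvPolynomial (Fin r) K,
      eval p e = 1 ∧ (z ≠ p → eval z e = 0) := by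
    intro z
    by_cases hz : z = p
    · exact ⟨1, by simp, fun hne => absurd hz hne⟩
    · obtain ⟨i, hi⟩ := Function.ne_iff.1 hz
      refine ⟨C (p i - z i)⁻¹ * (X i - C (z i)), ?_, fun _ => by simp⟩
      simp [inv_mul_cancel₀ (sub_ne_zero.2 (Ne.symm hi))]
  choose e he₁ he₀ using hsep
  refine ⟨∏ z ∈ F, e z, by simp [map_prod, he₁], fun z hz hzp => ?_⟩
  rw [map_prod]
  exact Finset.prod_eq_zero hz (he₀ z hzp)

/-- If `p` is the only zero of `I` at which `f` does not vanish, then the vanishing ideal of `p`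
is a minimal prime of `I`. -/
lemma ker_eval_mem_minimalPrimes [IsAlgClosed K] {I : Ideal (MvPolynomial (Fin r) K)}
    {p : Fin r → K} {f : MvPolynomial (Fin r) K} (hI : I ≤ RingHom.ker (eval p))
    (hf : eval p f ≠ 0)
    (hiso : ∀ z, (∀ g ∈ I, eval z g = 0) → z ≠ p → eval z f = 0) :
    RingHom.ker (eval p) ∈ I.minimalPrimes := by
  refine ⟨⟨RingHom.ker_isPrime _, hI⟩, ?_⟩
  rintro q ⟨hq, hIq⟩ hqp g hg
  have hfg : f * g ∈ vanishingIdeal K (zeroLocus K q) := by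
    intro z hz
    rw [mem_zeroLocus_iff] at hz
    simp only [aeval_eq_eval] at hz ⊢
    rw [map_mul]
    by_cases hzp : z = p
    · rw [hzp, (RingHom.mem_ker).1 hg, mul_zero]
    · rw [hiso z (fun g hg => hz g (hIq hg)) hzp, zero_mul]
  rw [IsPrime.vanishingIdeal_zeroLocus] at hfg
  exact (hq.mem_or_mem hfg).resolve_left fun hfq => hf (hqp hfq)

end Isolated

section Bezout

variable {K : Type*} [Field K] [IsAlgClosed K] {r : ℕ}

/-- If the points of a finite set are isolated zeros of `h₁, …, h_r`, then the products of
interpolation polynomials at these points with the monomials in the `h_i` are linearly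
independent. -/
lemma linearIndependent_mul_prod_pow (F : Finset (Fin r → K)) (k : Fin r)
    (h : Fin r → MvPolynomial (Fin r) K)
    (hmin : ∀ p ∈ F, RingHom.ker (eval p) ∈ (Ideal.span (Set.range h)).minimalPrimes)
    (e : F → MvPolynomial (Fin r) K) (he₁ : ∀ p : F, eval p.1 (e p) = 1)
    (he₀ : ∀ p z : F, z ≠ p → eval z.1 (e p) = 0) :
    LinearIndependent K fun x : F × (Fin r →₀ ℕ) => e x.1 * ∏ i, h i ^ x.2 i := by
  classical
  have : Infinite K := IsAlgClosed.instInfinite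
  rw [linearIndependent_iff]
  intro c hc
  by_contra hne
  obtain ⟨⟨p, j₀⟩, hpj, hjmin⟩ := Finset.exists_min_image c.support (fun x => x.2.degree)
    (Finsupp.support_nonempty_iff.2 hne)
  let G : MvPolynomial (Fin r) (MvPolynomial (Fin r) K) :=
    ∑ x ∈ c.support, monomial x.2 (C (c x) * e x.1)
  have hcoeff : ∀ j, coeff j G = ∑ x ∈ c.support, if x.2 = j then C (c x) * e x.1 else 0 := by
    intro j
    simp [G, coeff_sum, coeff_monomial]
  refine eval_ne_zero_of_isolated p.1 h (hmin p p.2) k G j₀.degree ?_ j₀ rfl ?_ ?_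
  · intro j hj
    rw [mem_support_iff, hcoeff] at hj
    obtain ⟨x, hx, hxj⟩ := Finset.exists_ne_zero_of_sum_ne_zero hj
    have hxj' : x.2 = j := by
      by_contra hcon
      simp [hcon] at hxj
    exact hxj' ▸ hjmin x hx
  · have : eval p.1 (coeff j₀ G) = c (p, j₀) := by
      rw [hcoeff, map_sum, Finset.sum_eq_single (p, j₀)]
      · simp [he₁]
      · rintro ⟨z, j⟩ - hzj
        by_cases hj : j = j₀
        · subst hj
          have hz : p ≠ z := fun hz => hzj (by rw [hz])
          simp [he₀ z p hz]
        · simp [hj]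
      · intro hcon
        exact absurd hpj hcon
    rw [this]
    exact Finsupp.mem_support_iff.1 hpj
  · rw [Finsupp.linearCombination_apply, Finsupp.sum] at hc
    rw [← hc, map_sum]
    refine Finset.sum_congr rfl fun x _ => ?_
    rw [eval_monomial, Finsupp.prod_fintype _ _ (fun _ => pow_zero _), smul_eq_C_mul, mul_assoc]

/-- The affine Bézout inequality for isolated zeros. -/
theorem card_le_prod_totalDegree_of_isolated (F : Finset (Fin r → K)) (hF : F.Nonempty)
    (k : Fin r) (h : Fin r → MvPolynomial (Fin r) K)
    (hmin : ∀ p ∈ F, RingHom.ker (eval p) ∈ (Ideal.span (Set.range h)).minimalPrimes) :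
    F.card ≤ ∏ i, (h i).totalDegree := by
  classical
  choose e he₁ he₀ using fun p : F => exists_eval_eq_ite F p.1
  have hli := linearIndependent_mul_prod_pow F k h hmin e he₁
    fun p z hzp => he₀ p z.1 z.2 fun hcon => hzp (Subtype.ext hcon)
  have hpos : ∀ i, 0 < (h i).totalDegree := by
    intro i
    obtain ⟨p, hp⟩ := hF
    by_contra! hdeg
    have hC := totalDegree_eq_zero_iff_eq_C.1 (Nat.le_zero.1 hdeg)
    have hzero : eval p (h i) = 0 := (hmin p hp).1.2 (Ideal.subset_span ⟨i, rfl⟩)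
    rw [hC, eval_C] at hzero
    rw [hzero, C_0] at hC
    refine hli.ne_zero (⟨p, hp⟩, Finsupp.single i 1) ?_
    simp only
    rw [Finset.prod_eq_zero (Finset.mem_univ i) (by simp [hC]), mul_zero]
  let a := Finset.univ.sup fun p : F => (e p).totalDegree
  refine le_of_mul_le_mul_shift (a := a) (r := r) (T := fun m => Nat.card (exponentsLE r m))
    ?_ (card_exponentsLE_le r) fun m => ?_
  · have : Nonempty (exponentsLE r 0) := ⟨⟨0, by simp⟩⟩
    exact Nat.card_pos
  · have := finite_weightedExponentsLE hpos m
    have := Fintype.ofFinite (weightedExponentsLE (fun i => (h i).totalDegree) m)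
    let g : F × weightedExponentsLE (fun i => (h i).totalDegree) m →
        restrictTotalDegree (Fin r) K (m + a) := fun x =>
      ⟨e x.1 * ∏ i, h i ^ x.2.1 i, by
        rw [mem_restrictTotalDegree, add_comm m a]
        refine (totalDegree_mul _ _).trans (add_le_add
          (Finset.le_sup (f := fun p : F => (e p).totalDegree) (Finset.mem_univ x.1)) ?_)
        exact (totalDegree_finsetProd _ _).trans
          ((Finset.sum_le_sum fun i _ => totalDegree_pow _ _).trans x.2.2)⟩
    have hg : LinearIndependent K g := by
      refine LinearIndependent.of_comp (restrictTotalDegree (Fin r) K (m + a)).subtype ?_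
      exact hli.comp (fun x : F × weightedExponentsLE (fun i => (h i).totalDegree) m =>
        (x.1, x.2.1)) fun x y hxy => by
          simp only [Prod.mk.injEq] at hxy
          exact Prod.ext hxy.1 (Subtype.ext hxy.2)
    have hcard := hg.fintype_card_le_finrank
    have hfin : Module.finrank K (restrictTotalDegree (Fin r) K (m + a)) =
        Nat.card (exponentsLE r (m + a)) :=
      Module.finrank_eq_nat_card_basis (basisRestrictSupport K (exponentsLE r (m + a)))
    rw [hfin, Fintype.card_prod, Fintype.card_coe, ← Nat.card_eq_fintype_card] at hcard
    calc F.card * Nat.card (exponentsLE r m)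
        ≤ F.card * ((∏ i, (h i).totalDegree) *
          Nat.card (weightedExponentsLE (fun i => (h i).totalDegree) m)) :=
          Nat.mul_le_mul_left _ (card_exponentsLE_le_mul hpos m)
      _ = (∏ i, (h i).totalDegree) * (F.card *
          Nat.card (weightedExponentsLE (fun i => (h i).totalDegree) m)) := by ring
      _ ≤ _ := Nat.mul_le_mul_left _ hcard

end Bezout

/-- Let `K` be algebraically closed, `U ⊆ K^r` a nonempty
Zariski-open set, and `h₁,…,h_r` polynomials with `deg h_i = d_i`, with zero
loci `Z_i`.  If `F := ⋂ᵢ (Z_i ∩ U)` is nonempty and finite then `F` has at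
most `D = d₁⋯d_r` elements. -/
theorem stmt15 {K : Type*} [Field K] [IsAlgClosed K] {r : ℕ}
    {ι : Type*} (Q : ι → MvPolynomial (Fin r) K)
    (U : Set (Fin r → K)) (hU : U = {x : Fin r → K | ∃ i, eval x (Q i) ≠ 0})
    (hUne : U.Nonempty)
    (h : Fin r → MvPolynomial (Fin r) K) (d : Fin r → ℕ)
    (hd : ∀ i, (h i).totalDegree = d i)
    (F : Set (Fin r → K))
    (hF : F = ⋂ i : Fin r, ({x : Fin r → K | eval x (h i) = 0} ∩ U))
    (hFne : F.Nonempty) (hFfin : F.Finite) :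
    F.ncard ≤ ∏ i, d i := by
  obtain rfl | hr := Nat.eq_zero_or_pos r
  · simpa using Set.ncard_le_one_of_subsingleton F
  have hmem : ∀ z, z ∈ F ↔ (∀ i, eval z (h i) = 0) ∧ ∃ i, eval z (Q i) ≠ 0 := by
    intro z
    have : Nonempty (Fin r) := ⟨⟨0, hr⟩⟩
    simp [hF, hU, forall_and]
  lift F to Finset (Fin r → K) using hFfin
  rw [Set.ncard_coe_finset]
  simp_rw [← hd]
  refine card_le_prod_totalDegree_of_isolated F (by simpa using hFne) ⟨0, hr⟩ h fun p hp => ?_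
  obtain ⟨hp0, i, hi⟩ := (hmem p).1 (Finset.mem_coe.2 hp)
  obtain ⟨e, he₁, he₀⟩ := exists_eval_eq_ite F p
  refine ker_eval_mem_minimalPrimes (f := Q i * e) ?_ (by simpa [he₁] using hi) fun z hz hzp => ?_
  · rw [Ideal.span_le]
    rintro _ ⟨i, rfl⟩
    exact hp0 i
  · rw [map_mul]
    by_cases hQ : eval z (Q i) = 0
    · rw [hQ, zero_mul]
    · rw [he₀ z (Finset.mem_coe.1 ((hmem z).2
        ⟨fun i => hz _ (Ideal.subset_span ⟨i, rfl⟩), i, hQ⟩)) hzp, mul_zero]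
end

section
/- Let k be a local field of characteristic 0, f = (f₁,…,f_r) : k^m → k^r a polynomial map with df₁ ∧ … ∧ df_r not identically zero, d_i := deg f_i, and let c ∈ k^r be a non-critical value of f. Fix an r-element subset J ⊆ {1,…,m} and let π_J : k^m → k^{m−r} be the projection forgetting the coordinates indexed by J. Let L_{c,J} := {x ∈ k^m : f₁(x)=c₁,…,f_r(x)=c_r and ∂_J(x) ≠ 0}. Then every fiber of the restriction of π_J to L_{c,J} has cardinality at most D := d₁·d₂⋯d_r. -/
open MvPolynomial

/-- A function of polynomial growth cannot grow by a fixed factor `> 1` on each interval of fixed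
length. -/
theorem exists_mul_lt_succ_mul_of_le_pow (t : ℕ → ℕ) (n : ℕ) (ht : ∀ N, t N ≤ (N + 1) ^ n)
    (ht₀ : 0 < t 0) (D K : ℕ) (hD : 0 < D) : ∃ M, D * t (M + K) < (D + 1) * t M := by
  by_contra! hcon
  have hgrow (j : ℕ) : (D + 1) ^ j ≤ D ^ j * t (j * K) := by
    induction j with
    | zero => simpa using Nat.one_le_iff_ne_zero.2 ht₀.ne'
    | succ j ih =>
      calc (D + 1) ^ (j + 1) = (D + 1) * (D + 1) ^ j := pow_succ' _ _
        _ ≤ (D + 1) * (D ^ j * t (j * K)) := by gcongr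
        _ = D ^ j * ((D + 1) * t (j * K)) := by ring
        _ ≤ D ^ j * (D * t (j * K + K)) := Nat.mul_le_mul_left _ (hcon _)
        _ = D ^ (j + 1) * t ((j + 1) * K) := by rw [Nat.succ_mul]; ring
  have hD' : (0 : ℝ) < D := by exact_mod_cast hD
  have hr : 1 < ((D + 1 : ℝ) / D) := by rw [one_lt_div hD']; linarith
  have hlim := (tendsto_pow_const_div_const_pow_of_one_lt n hr).const_mul (((K : ℝ) + 1) ^ n)
  rw [mul_zero] at hlim
  obtain ⟨j, hj, hj1⟩ :=
    ((hlim.eventually_lt_const one_pos).and (Filter.eventually_ge_atTop 1)).exists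
  have hpos : (0 : ℝ) < ((D + 1 : ℝ) / D) ^ j := by positivity
  rw [← mul_div_assoc, div_lt_one hpos, div_pow, lt_div_iff₀ (by positivity), ← mul_pow] at hj
  have h1 : ((D : ℝ) + 1) ^ j ≤ D ^ j * (j * K + 1) ^ n := by
    exact_mod_cast (hgrow j).trans (Nat.mul_le_mul_left _ (ht _))
  have h2 : ((j : ℝ) * K + 1) ^ n ≤ ((K + 1) * j) ^ n := by
    have : (1 : ℝ) ≤ j := by exact_mod_cast hj1
    gcongr
    linarith
  have h3 : (D : ℝ) ^ j * (j * K + 1) ^ n ≤ D ^ j * ((K + 1) * j) ^ n := by gcongr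
  linarith

/-- The exponents `a` whose weighted degree `∑ i, d i * a i` is at most `N`. -/
def boundedExponents {σ : Type*} [Fintype σ] [DecidableEq σ] (d : σ → ℕ) (N : ℕ) :
    Finset (σ → ℕ) :=
  {a ∈ Fintype.piFinset fun _ => Finset.range (N + 1) | ∑ i, d i * a i ≤ N}

section boundedExponents

variable {σ : Type*} [Fintype σ] [DecidableEq σ] {d : σ → ℕ}

theorem mem_boundedExponents (hd : ∀ i, 0 < d i) {N : ℕ} {a : σ → ℕ} :
    a ∈ boundedExponents d N ↔ ∑ i, d i * a i ≤ N := by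
  simp only [boundedExponents, Finset.mem_filter, Fintype.mem_piFinset, Finset.mem_range,
    and_iff_right_iff_imp]
  intro h i
  have h1 := Finset.single_le_sum (f := fun i => d i * a i) (fun _ _ => Nat.zero_le _)
    (Finset.mem_univ i)
  have h2 := Nat.le_mul_of_pos_left (a i) (hd i)
  omega

theorem card_boundedExponents_le (d : σ → ℕ) (N : ℕ) :
    (boundedExponents d N).card ≤ (N + 1) ^ Fintype.card σ := by
  refine (Finset.card_filter_le _ _).trans ?_
  simp

theorem card_boundedExponents_one_le (hd : ∀ i, 0 < d i) (N : ℕ) :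
    (boundedExponents (1 : σ → ℕ) N).card ≤ (∏ i, d i) * (boundedExponents d N).card := by
  have hcard : (∏ i, d i) * (boundedExponents d N).card =
      ((Fintype.piFinset fun i => Finset.range (d i)) ×ˢ boundedExponents d N).card := by
    simp
  rw [hcard]
  refine Finset.card_le_card_of_injOn (fun a => (fun i => a i % d i, fun i => a i / d i)) ?_ ?_
  · intro a ha
    rw [Finset.mem_coe, mem_boundedExponents (by simp)] at ha
    simp only [Finset.coe_product, Set.mem_prod, Finset.mem_coe, Fintype.mem_piFinset,
      Finset.mem_range, mem_boundedExponents hd]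
    refine ⟨fun i => Nat.mod_lt _ (hd i), le_trans (Finset.sum_le_sum fun i _ => ?_) ha⟩
    simpa using Nat.mul_div_le (a i) (d i)
  · intro a _ b _ hab
    simp only [Prod.mk.injEq, funext_iff] at hab
    ext i
    rw [← Nat.mod_add_div (a i) (d i), ← Nat.mod_add_div (b i) (d i), hab.1, hab.2]

end boundedExponents

theorem finrank_restrictTotalDegree_le {σ k : Type*} [Fintype σ] [DecidableEq σ] [Field k]
    (N : ℕ) : Module.finrank k (restrictTotalDegree σ k N) ≤
      (boundedExponents (1 : σ → ℕ) N).card := by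
  rw [restrictTotalDegree, Module.finrank_eq_nat_card_basis (basisRestrictSupport k _),
    ← Nat.card_eq_finsetCard]
  refine Nat.card_le_card_of_injective (fun a => ⟨a.1, ?_⟩) fun a b hab => ?_
  · rw [mem_boundedExponents (by simp)]
    simpa [Finsupp.sum_fintype] using a.2
  · exact Subtype.ext (DFunLike.coe_injective (congrArg Subtype.val hab))

/-- If `g` is a family of `n` nonconstant polynomials in `n` variables, every polynomial `h`
satisfies an algebraic equation of degree at most `∏ i, deg (g i)` over the algebra generated
by `g`. -/
theorem exists_polynomial_eval₂_aeval_eq_zero {σ k : Type*} [Fintype σ] [Field k]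
    (g : σ → MvPolynomial σ k) (hg : ∀ i, 0 < (g i).totalDegree) (h : MvPolynomial σ k) :
    ∃ Q : Polynomial (MvPolynomial σ k), Q ≠ 0 ∧ Q.natDegree ≤ ∏ i, (g i).totalDegree ∧
      Q.eval₂ (aeval g : MvPolynomial σ k →ₐ[k] MvPolynomial σ k).toRingHom h = 0 := by
  classical
  set d : σ → ℕ := fun i => (g i).totalDegree with hd
  set D := ∏ i, d i with hD
  obtain ⟨M, hM⟩ := exists_mul_lt_succ_mul_of_le_pow
    (fun N => (boundedExponents (1 : σ → ℕ) N).card) _ (card_boundedExponents_le _)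
    (Finset.card_pos.2 ⟨0, by simp [mem_boundedExponents]⟩) D (D * h.totalDegree)
    (Finset.prod_pos fun i _ => hg i)
  let I := boundedExponents d M × Fin (D + 1)
  have hmem (p : I) : (∏ i, g i ^ p.1.1 i) * h ^ (p.2 : ℕ) ∈
      restrictTotalDegree σ k (M + D * h.totalDegree) := by
    rw [mem_restrictTotalDegree]
    refine (totalDegree_mul _ _).trans (add_le_add ?_ ?_)
    · refine (totalDegree_finsetProd _ _).trans ?_
      refine le_trans (Finset.sum_le_sum fun i _ => ?_) ((mem_boundedExponents hg).1 p.1.2)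
      rw [mul_comm]
      exact totalDegree_pow _ _
    · exact (totalDegree_pow _ _).trans (Nat.mul_le_mul_right _ (Nat.le_of_lt_succ p.2.2))
  let v : I → restrictTotalDegree σ k (M + D * h.totalDegree) := fun p => ⟨_, hmem p⟩
  have hv : ¬ LinearIndependent k v := by
    intro hv
    have h1 := hv.fintype_card_le_finrank.trans (finrank_restrictTotalDegree_le _)
    simp only [I, Fintype.card_prod, Fintype.card_coe, Fintype.card_fin] at h1
    have h2 := card_boundedExponents_one_le hg M
    have h3 := Nat.mul_le_mul_left D h1
    have h4 := Nat.mul_le_mul_left (D + 1) h2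
    rw [← hd, ← hD] at h4
    nlinarith
  obtain ⟨a, ha, p₀, hp₀⟩ := Fintype.not_linearIndependent_iff.1 hv
  let e : (σ → ℕ) ≃ (σ →₀ ℕ) := Finsupp.equivFunOnFinite.symm
  refine ⟨∑ p : I, Polynomial.monomial (p.2 : ℕ) (monomial (e p.1.1) (a p)), ?_, ?_, ?_⟩
  · intro h0
    apply hp₀
    have h1 := congrArg (fun Q => coeff (e p₀.1.1) (Q.coeff (p₀.2 : ℕ))) h0
    simp only [Polynomial.finsetSum_coeff, Polynomial.coeff_monomial, Polynomial.coeff_zero,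
      coeff_zero, coeff_sum] at h1
    rw [Finset.sum_eq_single p₀] at h1
    · simpa using h1
    · intro p _ hp
      split_ifs with h2
      · rw [coeff_monomial, if_neg]
        intro h3
        exact hp (Prod.ext (Subtype.ext (e.injective h3)) (Fin.ext h2))
      · simp
    · simp
  · exact Polynomial.natDegree_sum_le_of_forall_le _ _ fun p _ =>
      (Polynomial.natDegree_monomial_le _).trans (Nat.le_of_lt_succ p.2.2)
  · have h1 := congrArg Subtype.val ha
    simp only [Submodule.coe_sum, Submodule.coe_smul, v, Submodule.coe_zero] at h1
    rw [← h1, Polynomial.eval₂_finsetSum]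
    refine Finset.sum_congr rfl fun p _ => ?_
    rw [Polynomial.eval₂_monomial]
    simp only [AlgHom.toRingHom_eq_coe, RingHom.coe_coe, aeval_monomial, algebraMap_eq,
      smul_eq_C_mul, mul_assoc]
    rw [Finsupp.prod_fintype _ _ (by simp)]
    rfl

/-- A nonzero polynomial does not vanish identically on any neighbourhood. -/
theorem exists_mem_eval_ne_zero {σ k : Type*} [Finite σ] [NontriviallyNormedField k]
    {p : MvPolynomial σ k} (hp : p ≠ 0) {c : σ → k} {U : Set (σ → k)} (hU : U ∈ nhds c) :
    ∃ x ∈ U, eval x p ≠ 0 := by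
  by_contra! hcon
  rw [nhds_pi, Filter.mem_pi'] at hU
  obtain ⟨I, s, hs, hsU⟩ := hU
  refine hp (funext_set s (fun i => infinite_of_mem_nhds (c i) (hs i)) fun x hx => ?_)
  rw [map_zero]
  exact hcon x (hsU fun i _ => hx i trivial)

/-- Finitely many points are separated by the values of some polynomial. -/
theorem exists_mvPolynomial_injOn {σ k : Type*} [Fintype σ] [Field k] [Infinite k]
    (A : Finset (σ → k)) : ∃ h : MvPolynomial σ k, Set.InjOn (fun x => eval x h) A := by
  classical
  let P := {p : A × A // p.1 ≠ p.2}
  obtain ⟨φ, hφ⟩ := Module.exists_dual_forall_apply_ne_zero (K := k)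
    (fun p : P => (p.1.1 : σ → k) - p.1.2) fun p => sub_ne_zero.2 fun h => p.2 (Subtype.ext h)
  refine ⟨∑ i, C (φ (Pi.single i 1)) * X i, fun x hx y hy hxy => ?_⟩
  have heval (z : σ → k) : eval z (∑ i, C (φ (Pi.single i 1)) * X i) = φ z := by
    conv_rhs => rw [pi_eq_sum_univ' z, map_sum]
    simp [mul_comm]
  simp only [heval] at hxy
  by_contra hne
  refine hφ ⟨(⟨x, hx⟩, ⟨y, hy⟩), fun h => hne (congrArg Subtype.val h)⟩ ?_
  simp [hxy]

/-- **Bézout inequality**: a polynomial map in as many variables as components has, in the fibre over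
`c`, at most as many points where it is locally open as the product of the degrees of its
components. -/
theorem card_le_prod_totalDegree_of_nhds_le_map {σ k : Type*} [Fintype σ]
    [NontriviallyNormedField k] (g : σ → MvPolynomial σ k)
    (c : σ → k) (A : Finset (σ → k))
    (hA : ∀ x ∈ A, nhds c ≤ Filter.map (fun z i => eval z (g i)) (nhds x)) :
    A.card ≤ ∏ i, (g i).totalDegree := by
  classical
  obtain rfl | ⟨x₀, hx₀⟩ := A.eq_empty_or_nonempty
  · simp
  have hg (i) : 0 < (g i).totalDegree := by
    by_contra hi
    rw [not_lt, Nat.le_zero, totalDegree_eq_zero_iff_eq_C] at hi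
    have hX : X i - C (coeff 0 (g i)) ≠ 0 := sub_ne_zero.2 fun h => by
      simpa using congrArg totalDegree h
    obtain ⟨z, ⟨w, rfl⟩, hw⟩ := exists_mem_eval_ne_zero hX (hA x₀ hx₀ Filter.range_mem_map)
    simp only [map_sub, eval_X, eval_C] at hw
    rw [hi] at hw
    simp at hw
  obtain ⟨h, hh⟩ := exists_mvPolynomial_injOn A
  obtain ⟨Q, hQ, hdeg, hQ0⟩ := exists_polynomial_eval₂_aeval_eq_zero g hg h
  obtain ⟨V, hV, hVdisj⟩ :=
    (A.finite_toSet.image (fun x => eval x h)).t2_separation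
  have hU : (⋂ x ∈ A, (fun z i => eval z (g i)) '' ((fun z => eval z h) ⁻¹' V (eval x h))) ∈
      nhds c := by
    rw [Filter.biInter_finset_mem]
    intro x hx
    refine hA x hx (Filter.image_mem_map ?_)
    exact (MvPolynomial.continuous_eval h).continuousAt.preimage_mem_nhds
      ((hV _).2.mem_nhds (hV _).1)
  obtain ⟨c', hc', hne⟩ := exists_mem_eval_ne_zero (Polynomial.leadingCoeff_ne_zero.2 hQ) hU
  simp only [Set.mem_iInter, Set.mem_image, Set.mem_preimage] at hc'
  choose! b hbV hbc using hc'
  set q : Polynomial k := Q.map (eval c') with hq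
  have hq0 : q ≠ 0 := fun h0 => hne <| by
    rw [Polynomial.leadingCoeff, ← Polynomial.coeff_map, ← hq, h0, Polynomial.coeff_zero]
  have hroot (x) (hx : x ∈ A) : q.IsRoot (eval (b x) h) := by
    have h1 := congrArg (eval (b x)) hQ0
    rw [map_zero, Polynomial.hom_eval₂] at h1
    rw [Polynomial.IsRoot, hq, Polynomial.eval_map, ← h1]
    congr 1
    ext i
    · change eval c' (C i) = eval (b x) (aeval g (C i))
      rw [aeval_C, algebraMap_eq, eval_C, eval_C]
    · simpa using (congrFun (hbc x hx) i).symm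
  calc A.card ≤ q.roots.toFinset.card := by
        refine Finset.card_le_card_of_injOn (fun x => eval (b x) h)
          (fun x hx => by simpa [hq0] using hroot x hx) fun x hx y hy hxy => ?_
        by_contra hxy'
        have := hVdisj ⟨x, hx, rfl⟩ ⟨y, hy, rfl⟩ (fun h' => hxy' (hh hx hy h'))
        refine Set.disjoint_left.1 this (hbV x hx) ?_
        simp only at hxy
        rw [hxy]
        exact hbV y hy
    _ ≤ Multiset.card q.roots := Multiset.toFinset_card_le _
    _ ≤ q.natDegree := Polynomial.card_roots' _
    _ ≤ Q.natDegree := Polynomial.natDegree_map_le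
    _ ≤ _ := hdeg

theorem hasStrictFDerivAt_eval {σ k : Type*} [Fintype σ] [NontriviallyNormedField k]
    (p : MvPolynomial σ k) (x : σ → k) :
    HasStrictFDerivAt (fun z => eval z p)
      (∑ j, eval x (pderiv j p) • ContinuousLinearMap.proj (R := k) (φ := fun _ : σ => k) j) x := by
  classical
  induction p using MvPolynomial.induction_on with
  | C a =>
    simp only [eval_C]
    refine (hasStrictFDerivAt_const (𝕜 := k) a x).congr_fderiv ?_
    ext v
    simp
  | add p q hp hq =>
    simp only [map_add]
    refine (hp.add hq).congr_fderiv ?_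
    ext v
    simp [← Finset.sum_add_distrib, ← add_mul]
  | mul_X p i hp =>
    simp only [map_mul, eval_X]
    refine (hp.mul (hasStrictFDerivAt_apply (𝕜 := k) (F' := fun _ : σ => k) i x)).congr_fderiv ?_
    ext v
    have hsum (j : σ) : eval x (pderiv j (p * X i)) * v j =
        (if i = j then eval x p * v j else 0) + x i * (eval x (pderiv j p) * v j) := by
      rw [pderiv_mul, pderiv_X, map_add, map_mul, map_mul, eval_X, Pi.single_apply]
      split_ifs <;> simp <;> ring
    simp only [sum_apply, smul_apply, add_apply, ContinuousLinearMap.proj_apply, smul_eq_mul,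
      hsum, Finset.sum_add_distrib, Finset.mul_sum]
    simp

theorem totalDegree_aeval_le {σ τ k : Type*} [Field k] (s : σ → MvPolynomial τ k)
    (hs : ∀ i, (s i).totalDegree ≤ 1) (p : MvPolynomial σ k) :
    (aeval s p).totalDegree ≤ p.totalDegree := by
  rw [aeval_def, eval₂_eq]
  refine totalDegree_finsetSum_le fun d hd => ?_
  refine (totalDegree_mul _ _).trans ?_
  rw [algebraMap_eq, totalDegree_C, zero_add]
  refine (totalDegree_finsetProd _ _).trans (le_trans ?_ (le_totalDegree hd))
  refine Finset.sum_le_sum fun i _ => (totalDegree_pow _ _).trans ?_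
  simpa using Nat.mul_le_mul_left (d i) (hs i)

/-- A polynomial map is locally open at each point where its Jacobian determinant in the variables
`ι` is nonzero, as a function of these variables. -/
theorem map_nhds_eval_extend {σ τ k : Type*} [Fintype σ] [Fintype τ] [DecidableEq τ]
    [NontriviallyNormedField k] [CompleteSpace k] (f : τ → MvPolynomial σ k) (ι : τ ↪ σ)
    (y : σ → k) (z : τ → k)
    (hdet : (Matrix.of fun a b => eval (Function.extend ι z y) (pderiv (ι b) (f a)) :
      Matrix τ τ k).det ≠ 0) :
    Filter.map (fun w i => eval (Function.extend ι w y) (f i)) (nhds z) =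
      nhds fun i => eval (Function.extend ι z y) (f i) := by
  classical
  set J : Matrix τ τ k :=
    Matrix.of fun a b => eval (Function.extend ι z y) (pderiv (ι b) (f a)) with hJ
  let L : (τ → k) →L[k] (σ → k) :=
    LinearMap.toContinuousLinearMap (Function.ExtendByZero.linearMap k ι)
  have hL (w : τ → k) : L w = Function.extend ι w 0 := rfl
  have hE : (fun w => Function.extend ι w y) = fun w => Function.extend ι (0 : τ → k) y + L w := by
    ext w j
    rw [hL, Pi.add_apply]
    by_cases hj : ∃ b, ι b = j
    · obtain ⟨b, rfl⟩ := hj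
      simp [ι.injective.extend_apply]
    · simp [Function.extend_apply' _ _ _ hj]
  have hE' : HasStrictFDerivAt (fun w : τ → k => Function.extend ι w y) L z := by
    rw [hE]
    exact L.hasStrictFDerivAt.const_add _
  have hF : HasStrictFDerivAt (fun w i => eval (Function.extend ι w y) (f i))
      (LinearMap.toContinuousLinearMap (Matrix.toLin' J)) z := by
    rw [hasStrictFDerivAt_pi']
    intro i
    refine ((hasStrictFDerivAt_eval (f i) _).comp z hE').congr_fderiv ?_
    ext1 v
    simp only [ContinuousLinearMap.comp_apply, sum_apply,
      smul_apply, ContinuousLinearMap.proj_apply, hL,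
      LinearMap.coe_toContinuousLinearMap', Matrix.toLin'_apply, Matrix.mulVec, dotProduct,
      hJ, Matrix.of_apply, smul_eq_mul]
    symm
    refine Finset.sum_of_injOn ι ι.injective.injOn (by simp) (fun j _ hj => ?_) fun b _ => ?_
    · rw [Function.extend_apply' _ _ _ (by simpa using hj)]
      simp
    · rw [ι.injective.extend_apply]
  refine hF.map_nhds_eq_of_surj (LinearMap.range_eq_top.2 fun w => ⟨J⁻¹.mulVec w, ?_⟩)
  simp [Matrix.mulVec_mulVec, Matrix.mul_nonsing_inv J (isUnit_iff_ne_zero.2 hdet)]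

theorem Set.finite_and_ncard_le_of_forall_finset {α : Type*} {s : Set α} {n : ℕ}
    (h : ∀ t : Finset α, ↑t ⊆ s → t.card ≤ n) : s.Finite ∧ s.ncard ≤ n := by
  have hs : s.Finite := by
    by_contra hs
    obtain ⟨t, hts, ht⟩ := Set.Infinite.exists_subset_card_eq hs (n + 1)
    have := h t hts
    omega
  refine ⟨hs, ?_⟩
  rw [Set.ncard_eq_toFinset_card s hs]
  exact h _ (by simp)

/-- Let `k` be a local field of characteristic 0,
`f = (f₁,…,f_r) : k^m → k^r` a polynomial map with `df₁ ∧ … ∧ df_r ≢ 0`, and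
`c` a non-critical value of `f`.  Fix an `r`-element subset `J ⊆ {1,…,m}`
(encoded as the range of an embedding `ι : Fin r ↪ Fin m`), let `π_J` be the
projection forgetting the coordinates in `J`, and let
`L_{c,J} = {x : f(x) = c, ∂_J(x) ≠ 0}`.  Then every fiber of `π_J` restricted
to `L_{c,J}` is finite with at most `D = d₁⋯d_r` elements, `d_i = deg f_i`. -/
theorem stmt16 {k : Type*} [NontriviallyNormedField k] [LocallyCompactSpace k]
    [CharZero k]
    {m r : ℕ} (f : Fin r → MvPolynomial (Fin m) k)
    (hrank : ∃ x : Fin m → k,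
      (Matrix.of fun i j => eval x (pderiv j (f i)) : Matrix (Fin r) (Fin m) k).rank = r)
    (c : Fin r → k)
    (hc : ¬ ∃ x : Fin m → k,
      (Matrix.of fun i j => eval x (pderiv j (f i)) : Matrix (Fin r) (Fin m) k).rank < r ∧
      ∀ i, eval x (f i) = c i)
    (ι : Fin r ↪ Fin m)
    (y : {i : Fin m // i ∉ Set.range ι} → k) :
    {x : Fin m → k |
        ((∀ i, eval x (f i) = c i) ∧
          (Matrix.of fun a b => eval x (pderiv (ι b) (f a)) :
              Matrix (Fin r) (Fin r) k).det ≠ 0) ∧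
        ∀ j : {i : Fin m // i ∉ Set.range ι}, x j = y j}.Finite ∧
    {x : Fin m → k |
        ((∀ i, eval x (f i) = c i) ∧
          (Matrix.of fun a b => eval x (pderiv (ι b) (f a)) :
              Matrix (Fin r) (Fin r) k).det ≠ 0) ∧
        ∀ j : {i : Fin m // i ∉ Set.range ι}, x j = y j}.ncard ≤
      ∏ i, (f i).totalDegree := by
  classical
  have : ProperSpace k := .of_locallyCompactSpace k
  let y₀ : Fin m → k := fun j => if h : j ∉ Set.range ι then y ⟨j, h⟩ else 0
  refine Set.finite_and_ncard_le_of_forall_finset fun A hA => ?_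
  have hext (x) (hx : x ∈ A) : Function.extend ι (x ∘ ι) y₀ = x := by
    ext j
    by_cases hj : ∃ b, ι b = j
    · obtain ⟨b, rfl⟩ := hj
      rw [ι.injective.extend_apply, Function.comp_apply]
    · rw [Function.extend_apply' _ _ _ hj]
      exact (dif_pos hj).trans ((hA hx).2 ⟨j, hj⟩).symm
  let s : Fin m → MvPolynomial (Fin r) k := Function.extend ι X fun j => C (y₀ j)
  have hs (z : Fin r → k) (p : MvPolynomial (Fin m) k) :
      eval z (aeval s p) = eval (Function.extend ι z y₀) p := by
    rw [← coe_aeval_eq_eval, RingHom.coe_coe, ← AlgHom.comp_apply, comp_aeval,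
      ← coe_aeval_eq_eval, RingHom.coe_coe]
    congr 2
    ext j
    by_cases hj : ∃ b, ι b = j
    · obtain ⟨b, rfl⟩ := hj
      simp [s, ι.injective.extend_apply]
    · simp [s, Function.extend_apply' _ _ _ hj]
  have hsdeg (j) : (s j).totalDegree ≤ 1 := by
    by_cases hj : ∃ b, ι b = j
    · obtain ⟨b, rfl⟩ := hj
      simp [s, ι.injective.extend_apply]
    · simp [s, Function.extend_apply' _ _ _ hj]
  calc A.card = (A.image fun x => x ∘ ι).card := by
        refine (Finset.card_image_of_injOn fun x hx x' hx' h => ?_).symm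
        rw [← hext x hx, ← hext x' hx']
        exact congrArg (Function.extend ι · y₀) h
    _ ≤ ∏ i, (aeval s (f i)).totalDegree := by
        refine card_le_prod_totalDegree_of_nhds_le_map _ c _ fun z hz => ?_
        obtain ⟨x, hx, rfl⟩ := Finset.mem_image.1 hz
        simp only [hs]
        rw [map_nhds_eval_extend f ι y₀ (x ∘ ι) (by rw [hext x hx]; exact (hA hx).1.2),
          hext x hx, funext (hA hx).1.1]
    _ ≤ ∏ i, (f i).totalDegree := by
        gcongr with i
        exact totalDegree_aeval_le s hsdeg (f i)
end
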